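/- arXiv:2104.12694 — 2 statements merged into one kernel-verified Lean document; each statement's English description precedes it below -/
import Mathlib

section
/- Let H be a complex separable Hilbert space and A a bounded operator on H whose spectrum consists only of the point zero. If the imaginary part Im(A) = (A − A*)/(2i) is a Hilbert–Schmidt operator, then the real part Re(A) = (A + A*)/2 is also a Hilbert–Schmidt operator; equivalently, A itself is Hilbert–Schmidt. -/
open ContinuousLinearMap
open Filter Topology
open scoped ENNReal InnerProductSpace

section Quasinilpotent

theorem eventually_norm_pow_le_of_spectralRadius_eq_zero {R : Type*} [NormedRing R]
    [NormedAlgebra ℂ R] [CompleteSpace R] {a : R} (ha : spectralRadius ℂ a = 0) {ε : ℝ}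
    (hε : 0 < ε) : ∀ᶠ n : ℕ in atTop, ‖a ^ n‖ ≤ ε ^ n := by
  have h := spectrum.pow_norm_pow_one_div_tendsto_nhds_spectralRadius a
  rw [ha] at h
  filter_upwards [h.eventually_lt_const (ENNReal.ofReal_pos.2 hε), eventually_gt_atTop 0]
    with n hn hn0
  have h1 := (ENNReal.ofReal_lt_ofReal_iff hε).1 hn
  have h2 := pow_le_pow_left₀ (by positivity) h1.le n
  rwa [← Real.rpow_natCast (_ ^ _) n, ← Real.rpow_mul (norm_nonneg _),
    one_div_mul_cancel (by positivity), Real.rpow_one] at h2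

theorem spectralRadius_eq_zero_of_spectrum_eq {R : Type*} [NormedRing R]
    [NormedAlgebra ℂ R] {a : R} (ha : spectrum ℂ a = {0}) : spectralRadius ℂ a = 0 := by
  simp [spectralRadius, ha]

end Quasinilpotent

section Compact

variable {H : Type*} [NormedAddCommGroup H] [InnerProductSpace ℂ H]

/-- Bounded operators converging strongly to zero converge uniformly on the image of the unit ball
under a compact operator. -/
theorem IsCompactOperator.eventually_norm_mul_le {ι : Type*} {l : Filter ι} {D : ι → H →L[ℂ] H}
    (hD : ∀ i, ‖D i‖ ≤ 1) (h : ∀ x, Tendsto (fun i => D i x) l (𝓝 0)) {A : H →L[ℂ] H}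
    (hA : IsCompactOperator A) {ε : ℝ} (hε : 0 < ε) : ∀ᶠ i in l, ‖D i * A‖ ≤ ε := by
  have hK := (IsCompactOperator.isCompact_closure_image_closedBall (f := (A : H →ₗ[ℂ] H)) hA
    1).totallyBounded
  obtain ⟨t, ht, hcov⟩ := Metric.totallyBounded_iff.1 hK (ε / 2) (half_pos hε)
  have hev : ∀ᶠ i in l, ∀ y ∈ t, ‖D i y‖ < ε / 2 := by
    refine (Filter.eventually_all_finite ht).2 fun y _ => ?_
    have := (h y).norm
    rw [norm_zero] at this
    exact this.eventually_lt_const (half_pos hε)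
  filter_upwards [hev] with i hi
  refine ContinuousLinearMap.opNorm_le_of_unit_norm hε.le fun x hx => ?_
  have hx' : A x ∈ closure ((A : H →ₗ[ℂ] H) '' Metric.closedBall 0 1) :=
    subset_closure ⟨x, by simp [hx], rfl⟩
  obtain ⟨y, hy, hxy⟩ := Set.mem_iUnion₂.1 (hcov hx')
  rw [Metric.mem_ball, dist_eq_norm] at hxy
  calc ‖(D i * A) x‖ = ‖D i (A x - y) + D i y‖ := by simp
    _ ≤ ‖D i (A x - y)‖ + ‖D i y‖ := norm_add_le _ _
    _ ≤ ‖A x - y‖ + ‖D i y‖ := by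
        gcongr
        simpa using (D i).le_of_opNorm_le (hD i) (A x - y)
    _ ≤ ε := by linarith [hi y hy]

theorem isCompactOperator_starProjection (U : Submodule ℂ H) [FiniteDimensional ℂ U] :
    IsCompactOperator U.starProjection :=
  (isCompactOperator_of_locallyCompactSpace_rng U.subtypeL).comp_clm U.orthogonalProjectionOnto

theorem isCompactOperator_pow_sub_pow {S T : H →L[ℂ] H} (h : IsCompactOperator (S - T)) (n : ℕ) :
    IsCompactOperator (S ^ n - T ^ n) := by
  induction n with
  | zero => simpa using! isCompactOperator_zero
  | succ n ih =>
    have h1 : S ^ (n + 1) - T ^ (n + 1) = S ^ n * (S - T) + (S ^ n - T ^ n) * T := by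
      rw [pow_succ, pow_succ]; noncomm_ring
    rw [h1]
    exact (h.clm_comp (S ^ n)).add (ih.comp_clm T)

variable [CompleteSpace H]

theorem norm_mul_pow_two_pow_le {R E : H →L[ℂ] H} (hR : IsSelfAdjoint R) (hE : ‖E‖ ≤ 1) (k : ℕ) :
    ‖R * E‖ ^ 2 ^ k ≤ ‖R ^ 2 ^ k * E‖ := by
  induction k with
  | zero => simp
  | succ k ih =>
    calc ‖R * E‖ ^ 2 ^ (k + 1) = (‖R * E‖ ^ 2 ^ k) ^ 2 := by ring
      _ ≤ ‖R ^ 2 ^ k * E‖ ^ 2 := by gcongr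
      _ = ‖star (R ^ 2 ^ k * E) * (R ^ 2 ^ k * E)‖ := by rw [CStarRing.norm_star_mul_self, sq]
      _ = ‖star E * (R ^ 2 ^ (k + 1) * E)‖ := by
        rw [star_mul, star_pow, hR.star_eq, mul_assoc, ← mul_assoc (R ^ _) (R ^ _), ← pow_add]
        congr 4
        ring
      _ ≤ ‖star E‖ * ‖R ^ 2 ^ (k + 1) * E‖ := norm_mul_le _ _
      _ ≤ 1 * ‖R ^ 2 ^ (k + 1) * E‖ := by rw [norm_star]; gcongr
      _ = _ := one_mul _

/-- A quasinilpotent operator which differs from a self-adjoint operator by a compact one is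
compact. -/
theorem isCompactOperator_of_quasinilpotent_of_sub_compact {A R : H →L[ℂ] H}
    (hA : ∀ ε : ℝ, 0 < ε → ∀ᶠ n : ℕ in atTop, ‖A ^ n‖ ≤ ε ^ n) (hR : IsSelfAdjoint R)
    (hRA : IsCompactOperator (R - A)) : IsCompactOperator A := by
  classical
  obtain ⟨s, b, -⟩ := exists_hilbertBasis ℂ H
  let U : Finset s → Submodule ℂ H := fun F => Submodule.span ℂ (F.image b : Set H)
  have hU : Monotone U := fun F G h =>
    Submodule.span_mono (by exact_mod_cast Finset.image_subset_image h)
  have hstrong : ∀ x, Tendsto (fun F => (1 - (U F).starProjection) x) atTop (𝓝 0) := fun x => by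
    have := Submodule.starProjection_tendsto_self U hU x b.finite_spans_dense.ge
    simpa using this.const_sub x
  have hnorm : ∀ F, ‖1 - (U F).starProjection‖ ≤ 1 := fun F => by
    have := (U F)ᗮ.starProjection_norm_le
    rwa [Submodule.starProjection_orthogonal'] at this
  have hself : ∀ F, IsSelfAdjoint (1 - (U F).starProjection) := fun F =>
    (IsSelfAdjoint.one _).sub (isSelfAdjoint_starProjection _)
  have key : Tendsto (fun F => R * (1 - (U F).starProjection)) atTop (𝓝 0) := by
    rw [NormedAddGroup.tendsto_nhds_zero]
    intro ε hε
    obtain ⟨k, hk⟩ : ∃ k : ℕ, ‖A ^ 2 ^ k‖ ≤ (ε / 4) ^ 2 ^ k :=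
      ((tendsto_pow_atTop_atTop_of_one_lt (one_lt_two : (1 : ℕ) < 2)).eventually
        (hA (ε / 4) (by positivity))).exists
    have hc := isCompactOperator_pow_sub_pow hRA (2 ^ k)
    filter_upwards [hc.eventually_norm_mul_le hnorm hstrong
      (show 0 < (ε / 4) ^ 2 ^ k by positivity)] with F hF
    set E := 1 - (U F).starProjection
    have h1 : ‖R * E‖ ^ 2 ^ k ≤ (ε / 2) ^ 2 ^ k := by
      calc ‖R * E‖ ^ 2 ^ k ≤ ‖R ^ 2 ^ k * E‖ := norm_mul_pow_two_pow_le hR (hnorm F) k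
        _ = ‖E * R ^ 2 ^ k‖ := by
          rw [← norm_star, star_mul, star_pow, hR.star_eq, (hself F).star_eq]
        _ = ‖E * (R ^ 2 ^ k - A ^ 2 ^ k) + E * A ^ 2 ^ k‖ := by rw [← mul_add, sub_add_cancel]
        _ ≤ ‖E * (R ^ 2 ^ k - A ^ 2 ^ k)‖ + ‖E‖ * ‖A ^ 2 ^ k‖ :=
          (norm_add_le _ _).trans (by gcongr; exact norm_mul_le _ _)
        _ ≤ (ε / 4) ^ 2 ^ k + 1 * (ε / 4) ^ 2 ^ k := by
          gcongr
          exact hnorm F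
        _ = 2 * (ε / 4) ^ 2 ^ k := by ring
        _ ≤ 2 ^ 2 ^ k * (ε / 4) ^ 2 ^ k := by
          gcongr
          exact le_self_pow₀ one_le_two (by positivity)
        _ = (ε / 2) ^ 2 ^ k := by rw [← mul_pow]; ring
    have h2 := le_of_pow_le_pow_left₀ (by positivity) (by positivity) h1
    linarith
  have hRc : IsCompactOperator R := by
    have hlim : Tendsto (fun F => R * (U F).starProjection) atTop (𝓝 R) := by
      have := key.const_sub R
      simpa [mul_sub] using this
    refine isCompactOperator_of_tendsto hlim (Eventually.of_forall fun F => ?_)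
    have : FiniteDimensional ℂ (U F) := FiniteDimensional.span_finset ℂ _
    exact (isCompactOperator_starProjection (U F)).clm_comp R
  have := hRc.sub hRA
  simpa using! this

end Compact

section HilbertSchmidt

variable {H : Type*} [NormedAddCommGroup H] [InnerProductSpace ℂ H]
  {ι : Type*} (b : HilbertBasis ι ℂ H)

/-- The square of the Hilbert–Schmidt norm of an operator, computed in a Hilbert basis. -/
noncomputable def hilbertSchmidtSq (T : H →L[ℂ] H) : ℝ≥0∞ := ∑' i, ‖T (b i)‖ₑ ^ 2

theorem hilbertSchmidtSq_ne_top_iff {T : H →L[ℂ] H} :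
    hilbertSchmidtSq b T ≠ ∞ ↔ Summable fun i => ‖T (b i)‖ ^ 2 := by
  have h : ∀ i, ‖T (b i)‖ₑ ^ 2 = ((‖T (b i)‖₊ ^ 2 : NNReal) : ℝ≥0∞) := fun i => by
    rw [enorm_eq_nnnorm]; norm_cast
  simp_rw [hilbertSchmidtSq, h]
  rw [ENNReal.tsum_coe_ne_top_iff_summable, ← NNReal.summable_coe]
  simp

theorem HilbertBasis.enorm_sq_eq_tsum (x : H) : ‖x‖ₑ ^ 2 = ∑' i, ‖⟪b i, x⟫_ℂ‖ₑ ^ 2 := by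
  have h := b.hasSum_inner_mul_inner x x
  have h2 : HasSum (fun i => ‖⟪b i, x⟫_ℂ‖ ^ 2) (‖x‖ ^ 2) := by
    have := Complex.hasSum_re h
    rw [show (⟪x, x⟫_ℂ).re = ‖x‖ ^ 2 from (inner_self_eq_norm_sq (𝕜 := ℂ) x)] at this
    convert this using 2 with i
    rw [← RCLike.re_eq_complex_re, inner_mul_symm_re_eq_norm, ← inner_conj_symm x (b i),
      norm_mul, RCLike.norm_conj, sq]
  have h3 := ENNReal.ofReal_tsum_of_nonneg (fun i => by positivity) h2.summable
  rw [h2.tsum_eq] at h3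
  simpa [ENNReal.ofReal_pow] using h3

theorem hilbertSchmidtSq_mul_le_left {P : H →L[ℂ] H} (hP : ‖P‖ ≤ 1) (T : H →L[ℂ] H) :
    hilbertSchmidtSq b (P * T) ≤ hilbertSchmidtSq b T := by
  refine ENNReal.tsum_le_tsum fun i => ?_
  gcongr
  rw [enorm_le_iff_norm_le]
  simpa using P.le_of_opNorm_le hP (T (b i))

theorem hilbertSchmidtSq_le_of_forall_exists {A : H →L[ℂ] H} {C : ℝ≥0∞}
    (h : ∀ ε : ℝ, 0 < ε → ∃ V : H →L[ℂ] H, hilbertSchmidtSq b V ≤ C ∧ ‖A - V‖ ≤ ε) :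
    hilbertSchmidtSq b A ≤ C := by
  choose V hV hAV using fun n : ℕ => h (1 / ((n : ℝ) + 1)) (by positivity)
  have hlim : Tendsto V atTop (𝓝 A) := by
    rw [tendsto_iff_norm_sub_tendsto_zero]
    refine squeeze_zero (fun _ => norm_nonneg _) (fun n => ?_) tendsto_one_div_add_atTop_nhds_zero_nat
    rw [norm_sub_rev]
    exact hAV n
  refine ENNReal.summable.tsum_le_of_sum_le fun F => ?_
  have h1 : Tendsto (fun n => ∑ i ∈ F, ‖V n (b i)‖ₑ ^ 2) atTop (𝓝 (∑ i ∈ F, ‖A (b i)‖ₑ ^ 2)) := by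
    refine tendsto_finsetSum _ fun i _ => ?_
    have h2 : Tendsto (fun n => V n (b i)) atTop (𝓝 (A (b i))) :=
      ((ContinuousLinearMap.apply ℂ H (b i)).continuous.tendsto A).comp hlim
    exact ENNReal.Tendsto.pow ((continuous_enorm.tendsto _).comp h2)
  exact le_of_tendsto' h1 fun n => (ENNReal.sum_le_tsum F).trans (hV n)

variable [CompleteSpace H]

theorem hilbertSchmidtSq_star (T : H →L[ℂ] H) :
    hilbertSchmidtSq b (star T) = hilbertSchmidtSq b T := by
  simp_rw [hilbertSchmidtSq, b.enorm_sq_eq_tsum]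
  rw [ENNReal.tsum_comm]
  refine tsum_congr fun i => tsum_congr fun j => ?_
  rw [star_eq_adjoint, adjoint_inner_right, ← inner_conj_symm, RCLike.enorm_conj]

theorem hilbertSchmidtSq_add {S T : H →L[ℂ] H} (h : S * star T = 0) :
    hilbertSchmidtSq b (S + T) = hilbertSchmidtSq b S + hilbertSchmidtSq b T := by
  rw [← hilbertSchmidtSq_star b (S + T), ← hilbertSchmidtSq_star b S, ← hilbertSchmidtSq_star b T,
    hilbertSchmidtSq, hilbertSchmidtSq, hilbertSchmidtSq, ← ENNReal.tsum_add]
  refine tsum_congr fun i => ?_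
  have h1 : ⟪star S (b i), star T (b i)⟫_ℂ = 0 := by
    rw [star_eq_adjoint S, adjoint_inner_left]
    have := DFunLike.congr_fun h (b i)
    simp only [mul_apply_eq_comp, zero_apply] at this
    rw [this, inner_zero_right]
  have h2 := norm_add_sq_eq_norm_sq_add_norm_sq_of_inner_eq_zero _ _ h1
  simp only [star_add, add_apply, ← ofReal_norm]
  rw [← ENNReal.ofReal_pow (norm_nonneg _), ← ENNReal.ofReal_pow (norm_nonneg _),
    ← ENNReal.ofReal_pow (norm_nonneg _), ← ENNReal.ofReal_add (by positivity) (by positivity)]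
  congr 1
  simpa [sq] using h2

theorem enorm_apply_sq_le_hilbertSchmidtSq (T : H →L[ℂ] H) (x : H) :
    ‖T x‖ₑ ^ 2 ≤ hilbertSchmidtSq b T * ‖x‖ₑ ^ 2 := by
  rw [b.enorm_sq_eq_tsum, ← hilbertSchmidtSq_star, hilbertSchmidtSq, ← ENNReal.tsum_mul_right]
  refine ENNReal.tsum_le_tsum fun i => ?_
  rw [← mul_pow, ← adjoint_inner_left, star_eq_adjoint]
  gcongr
  rw [← ofReal_norm, ← ofReal_norm, ← ofReal_norm, ← ENNReal.ofReal_mul (norm_nonneg _)]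
  exact ENNReal.ofReal_le_ofReal (norm_inner_le_norm _ _)

theorem isCompactOperator_of_hilbertSchmidtSq_ne_top {T : H →L[ℂ] H}
    (hT : hilbertSchmidtSq b T ≠ ∞) : IsCompactOperator T := by
  classical
  let U : Finset ι → Submodule ℂ H := fun F => Submodule.span ℂ (F.image b : Set H)
  have hval : ∀ F, hilbertSchmidtSq b (T - T * (U F).starProjection) =
      ∑' i : {i // i ∉ F}, ‖T (b i)‖ₑ ^ 2 := fun F => by
    rw [show (∑' i : {i // i ∉ F}, ‖T (b i)‖ₑ ^ 2) = _ from
      tsum_subtype {i | i ∉ F} fun i => ‖T (b i)‖ₑ ^ 2]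
    refine tsum_congr fun i => ?_
    by_cases hi : i ∈ F
    · have : (U F).starProjection (b i) = b i :=
        Submodule.starProjection_eq_self_iff.2
          (Submodule.subset_span (by simpa using ⟨i, hi, rfl⟩))
      simp [hi, this]
    · have : (U F).starProjection (b i) = 0 := by
        rw [Submodule.starProjection_apply_eq_zero_iff, Submodule.mem_orthogonal]
        intro u hu
        refine Submodule.span_induction (p := fun u _ => ⟪u, b i⟫_ℂ = 0) ?_ (by simp)
          (fun x y _ _ hx hy => by rw [inner_add_left, hx, hy, add_zero])
          (fun c x _ hx => by rw [inner_smul_left, hx, mul_zero]) hu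
        intro x hx
        obtain ⟨j, hj, rfl⟩ := Finset.mem_image.1 (Finset.mem_coe.1 hx)
        exact b.orthonormal.2 fun hji => hi (hji ▸ hj)
      simp [hi, this]
  have hlim : Tendsto (fun F => T * (U F).starProjection) atTop (𝓝 T) := by
    rw [tendsto_iff_norm_sub_tendsto_zero, Metric.tendsto_nhds]
    intro ε hε
    have h0 := ENNReal.tendsto_tsum_compl_atTop_zero hT
    filter_upwards [h0.eventually_lt_const
      (show (0 : ℝ≥0∞) < ENNReal.ofReal ((ε / 2) ^ 2) by simpa using by positivity)] with F hF
    rw [← hval F] at hF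
    have : ‖T * (U F).starProjection - T‖ ≤ ε / 2 := by
      rw [norm_sub_rev]
      refine ContinuousLinearMap.opNorm_le_bound _ (by positivity) fun x => ?_
      have h1 := (enorm_apply_sq_le_hilbertSchmidtSq b (T - T * (U F).starProjection) x).trans
        (mul_le_mul_left hF.le (‖x‖ₑ ^ 2))
      rw [← ofReal_norm, ← ofReal_norm, ← ENNReal.ofReal_pow (norm_nonneg _),
        ← ENNReal.ofReal_pow (norm_nonneg _), ← ENNReal.ofReal_mul (by positivity),
        ENNReal.ofReal_le_ofReal_iff (by positivity), ← mul_pow] at h1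
      exact le_of_sq_le_sq h1 (by positivity)
    rw [dist_zero_right, norm_norm]
    linarith
  refine isCompactOperator_of_tendsto hlim (Eventually.of_forall fun F => ?_)
  have : FiniteDimensional ℂ (U F) := FiniteDimensional.span_finset ℂ _
  exact (isCompactOperator_starProjection (U F)).clm_comp T

end HilbertSchmidt

section Hilden

open Polynomial

/-- Hilden's argument: a compact quasinilpotent operator vanishes on every invariant subspace on
which all of its nonzero vectors are cyclic. -/
theorem eq_zero_of_forall_cyclic {H : Type*} [NormedAddCommGroup H] [InnerProductSpace ℂ H]
    {B : H →L[ℂ] H} (hB : IsCompactOperator B)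
    (hq : ∀ ε : ℝ, 0 < ε → ∀ᶠ n : ℕ in atTop, ‖B ^ n‖ ≤ ε ^ n)
    {W : Submodule ℂ H} (hW : ∀ x ∈ W, B x ∈ W) (hWc : IsClosed (W : Set H))
    (hcyc : ∀ y ∈ W, y ≠ 0 → ∀ z ∈ W, ∀ δ : ℝ, 0 < δ → ∃ p : ℂ[X], ‖aeval B p y - z‖ < δ)
    {x : H} (hx : x ∈ W) : B x = 0 := by
  by_contra hne
  have hpos : 0 < ‖B x‖ := norm_pos_iff.2 hne
  obtain ⟨r, hr, hrB⟩ : ∃ r : ℝ, 0 < r ∧ ‖B‖ * r ≤ ‖B x‖ / 2 := by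
    refine ⟨‖B x‖ / (2 * (‖B‖ + 1)), by positivity, ?_⟩
    rw [mul_div_assoc', div_le_div_iff₀ (by positivity) (by positivity)]
    nlinarith [norm_nonneg B]
  let U : Set H := {u | u ∈ W ∧ ‖u - x‖ < r}
  have hUlow : ∀ u ∈ U, ‖B x‖ / 2 ≤ ‖B u‖ := fun u hu => by
    have h1 : ‖B (u - x)‖ ≤ ‖B x‖ / 2 :=
      ((B.le_opNorm _).trans (by gcongr; exact hu.2.le)).trans hrB
    have h2 : ‖B x‖ ≤ ‖B u‖ + ‖B (u - x)‖ := by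
      calc ‖B x‖ = ‖B u - B (u - x)‖ := by rw [map_sub, sub_sub_cancel]
        _ ≤ _ := norm_sub_le _ _
    linarith
  have hUb : Bornology.IsBounded U :=
    (Metric.isBounded_ball (x := x) (r := r)).subset fun u hu => by
      rw [Metric.mem_ball, dist_eq_norm]; exact hu.2
  have hK : IsCompact (closure (B '' U)) :=
    IsCompactOperator.isCompact_closure_image_of_bounded (f := (B : H →ₗ[ℂ] H)) hB hUb
  have hKW : closure (B '' U) ⊆ W :=
    closure_minimal (by rintro _ ⟨u, hu, rfl⟩; exact hW u hu.1) hWc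
  have hKlow : closure (B '' U) ⊆ {y | ‖B x‖ / 2 ≤ ‖y‖} :=
    closure_minimal (by rintro _ ⟨u, hu, rfl⟩; exact hUlow u hu)
      (isClosed_le continuous_const continuous_norm)
  obtain ⟨t, ht⟩ := hK.elim_finite_subcover
    (fun p : ℂ[X] => {y | ‖aeval B p y - x‖ < r})
    (fun p => isOpen_lt (by fun_prop) continuous_const) (fun y hy => by
      have hy0 : y ≠ 0 := by
        rintro rfl
        have := hKlow hy
        simp only [Set.mem_ofPred_eq, norm_zero] at this
        linarith
      obtain ⟨p, hp⟩ := hcyc y (hKW hy) hy0 x hx r hr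
      exact Set.mem_iUnion.2 ⟨p, hp⟩)
  obtain ⟨c, hc, hct⟩ : ∃ c : ℝ, 0 < c ∧ ∀ p ∈ t, ‖aeval B p‖ ≤ c :=
    ⟨∑ p ∈ t, ‖aeval B p‖ + 1, by positivity, fun p hp =>
      (Finset.single_le_sum (f := fun p => ‖aeval B p‖) (fun _ _ => norm_nonneg _) hp).trans
        (by linarith)⟩
  have hpW : ∀ p : ℂ[X], ∀ y ∈ W, aeval B p y ∈ W := fun p y hy => by
    induction p using Polynomial.induction_on' with
    | add p q hp hq => simpa using W.add_mem hp hq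
    | monomial n a =>
      have : ∀ n : ℕ, (B ^ n) y ∈ W := fun n => by
        induction n with
        | zero => simpa
        | succ n ih => rw [pow_succ']; exact hW _ ih
      rw [aeval_monomial, ← Algebra.smul_def]
      exact W.smul_mem a (this n)
  have hiter : ∀ k : ℕ, ∃ p : ℂ[X], ‖aeval B p‖ ≤ c ^ k ∧ aeval B p ((B ^ k) x) ∈ U := by
    intro k
    induction k with
    | zero =>
      refine ⟨1, ?_, by simpa [U] using ⟨hx, hr⟩⟩
      simpa using! ContinuousLinearMap.norm_id_le
    | succ k ih =>
      obtain ⟨p, hp, hpU⟩ := ih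
      obtain ⟨q, hqt, hq'⟩ := Set.mem_iUnion₂.1 (ht (subset_closure ⟨_, hpU, rfl⟩))
      have hcomm : aeval B (q * p) ((B ^ (k + 1)) x) =
          aeval B q (B (aeval B p ((B ^ k) x))) := by
        have h1 : aeval B (q * p) * B ^ (k + 1) = aeval B q * (B * (aeval B p * B ^ k)) := by
          have h2 : aeval B (q * p * X ^ (k + 1)) = aeval B (q * (X * (p * X ^ k))) := by
            congr 1; ring
          simpa [mul_assoc] using h2
        exact DFunLike.congr_fun h1 x
      refine ⟨q * p, ?_, ?_, ?_⟩
      · rw [map_mul, pow_succ']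
        exact (norm_mul_le _ _).trans (by gcongr; exact hct q hqt)
      · rw [hcomm]
        exact hpW _ _ (hW _ hpU.1)
      · rw [hcomm]
        exact hq'
  have hlim : Tendsto (fun n : ℕ => ‖B‖ * (1 / 2 : ℝ) ^ n * ‖x‖) atTop (𝓝 0) := by
    have := tendsto_pow_atTop_nhds_zero_of_lt_one (r := (1 / 2 : ℝ)) (by norm_num) (by norm_num)
    simpa using (this.const_mul ‖B‖).mul_const ‖x‖
  obtain ⟨n, hn1, hn2⟩ := ((hq (1 / (2 * c)) (by positivity)).and
    (hlim.eventually_lt_const (half_pos hpos))).exists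
  obtain ⟨p, hp, hpU⟩ := hiter n
  have h1 := hUlow _ hpU
  have h2 : ‖B (aeval B p ((B ^ n) x))‖ ≤ ‖B‖ * (c ^ n * ((1 / (2 * c)) ^ n * ‖x‖)) := by
    refine (B.le_opNorm _).trans ?_
    gcongr
    refine ((aeval B p).le_opNorm _).trans ?_
    gcongr
    exact (B ^ n).le_of_opNorm_le hn1 x
  have h3 : ‖B‖ * (c ^ n * ((1 / (2 * c)) ^ n * ‖x‖)) = ‖B‖ * (1 / 2 : ℝ) ^ n * ‖x‖ := by
    rw [← mul_assoc (c ^ n), ← mul_pow, show c * (1 / (2 * c)) = 1 / 2 by field_simp, mul_assoc]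
  linarith

end Hilden

section Gap

variable {H : Type*} [NormedAddCommGroup H] [InnerProductSpace ℂ H] [CompleteSpace H]

namespace ClosedSubmodule

/-- The orthogonal projection onto a closed subspace, as an operator on the whole space. -/
noncomputable def proj (M : ClosedSubmodule ℂ H) : H →L[ℂ] H := M.toSubmodule.starProjection

theorem proj_apply_mem (M : ClosedSubmodule ℂ H) (x : H) : M.proj x ∈ M :=
  M.toSubmodule.starProjection_apply_mem x

theorem proj_eq_self {M : ClosedSubmodule ℂ H} {x : H} (hx : x ∈ M) : M.proj x = x :=
  Submodule.starProjection_eq_self_iff.2 hx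

theorem proj_eq_zero_iff {M : ClosedSubmodule ℂ H} {x : H} :
    M.proj x = 0 ↔ x ∈ M.toSubmoduleᗮ :=
  Submodule.starProjection_apply_eq_zero_iff _

theorem star_proj (M : ClosedSubmodule ℂ H) : star M.proj = M.proj :=
  (isSelfAdjoint_starProjection M.toSubmodule).star_eq

theorem norm_proj_le (M : ClosedSubmodule ℂ H) : ‖M.proj‖ ≤ 1 :=
  M.toSubmodule.starProjection_norm_le

theorem proj_bot : (⊥ : ClosedSubmodule ℂ H).proj = 0 := by
  ext x
  simpa using (⊥ : ClosedSubmodule ℂ H).proj_apply_mem x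

theorem proj_top : (⊤ : ClosedSubmodule ℂ H).proj = 1 := by
  ext x
  simpa using proj_eq_self (M := ⊤) (x := x) (by simp)

theorem proj_orthogonal (M : ClosedSubmodule ℂ H) : Mᗮ.proj = 1 - M.proj :=
  M.toSubmodule.starProjection_orthogonal'

theorem proj_mul_proj_of_le {M N : ClosedSubmodule ℂ H} (h : M ≤ N) : N.proj * M.proj = M.proj := by
  ext x
  exact proj_eq_self (h (M.proj_apply_mem x))

theorem proj_mul_proj_of_le' {M N : ClosedSubmodule ℂ H} (h : M ≤ N) :
    M.proj * N.proj = M.proj := by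
  have := congr_arg star (proj_mul_proj_of_le h)
  rwa [star_mul, star_proj, star_proj] at this

theorem norm_proj_sub_proj_le {M N : ClosedSubmodule ℂ H} (h : M ≤ N) :
    ‖N.proj - M.proj‖ ≤ 1 := by
  have h1 : N.proj - M.proj = N.proj * Mᗮ.proj := by
    rw [proj_orthogonal, mul_sub, mul_one, proj_mul_proj_of_le h]
  rw [h1]
  exact (norm_mul_le _ _).trans (mul_le_one₀ N.norm_proj_le (norm_nonneg _) Mᗮ.norm_proj_le)

theorem mul_proj_of_invariant {A : H →L[ℂ] H} {M : ClosedSubmodule ℂ H} (hM : ∀ x ∈ M, A x ∈ M) :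
    M.proj * (A * M.proj) = A * M.proj := by
  ext x
  exact proj_eq_self (hM _ (M.proj_apply_mem x))

theorem exists_norm_proj_sSup_sub_mul_le {c : Set (ClosedSubmodule ℂ H)} (hc : IsChain (· ≤ ·) c)
    (hne : c.Nonempty) {A : H →L[ℂ] H} (hA : IsCompactOperator A) {ε : ℝ} (hε : 0 < ε) :
    ∃ M ∈ c, ‖((sSup c).proj - M.proj) * A‖ ≤ ε := by
  have : Nonempty c := hne.to_subtype
  have : IsDirectedOrder c := ⟨hc.directed⟩
  have hsup : (⨆ M : c, M.1.toSubmodule).topologicalClosure = (sSup c).toSubmodule := by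
    rw [sSup_eq_iSup', toSubmodule_iSup]
    rfl
  have hlim : ∀ x, Tendsto (fun M : c => ((sSup c).proj - M.1.proj) x) atTop (𝓝 0) := fun x => by
    have : (⨆ M : c, M.1.toSubmodule).topologicalClosure.HasOrthogonalProjection := by
      rw [hsup]; infer_instance
    have h := Submodule.starProjection_tendsto_closure_iSup (fun M : c => M.1.toSubmodule)
      (fun _ _ h => h) x
    have h2 : (⨆ M : c, M.1.toSubmodule).topologicalClosure.starProjection = (sSup c).proj := by
      simp only [hsup]
      rfl
    rw [h2] at h
    simpa using! h.const_sub ((sSup c).proj x)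
  obtain ⟨M, hM⟩ := (hA.eventually_norm_mul_le
    (fun M : c => norm_proj_sub_proj_le (le_sSup M.2)) hlim hε).exists
  exact ⟨M, M.2, hM⟩

theorem exists_norm_proj_sub_sInf_mul_le {c : Set (ClosedSubmodule ℂ H)} (hc : IsChain (· ≤ ·) c)
    (hne : c.Nonempty) {A : H →L[ℂ] H} (hA : IsCompactOperator A) {ε : ℝ} (hε : 0 < ε) :
    ∃ M ∈ c, ‖(M.proj - (sInf c).proj) * A‖ ≤ ε := by
  have hc' : IsChain (· ≤ ·) (orthogonal '' c) := by
    rintro _ ⟨M, hM, rfl⟩ _ ⟨N, hN, rfl⟩ -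
    exact (hc.total hM hN).symm.imp orthogonal_le orthogonal_le
  have hs : sSup (orthogonal '' c) = (sInf c)ᗮ := by
    rw [← orthogonal_orthogonal_eq (sSup _), ← sInf_orthogonal, iInf_image, sInf_eq_iInf]
    simp
  obtain ⟨_, ⟨M, hM, rfl⟩, h⟩ := exists_norm_proj_sSup_sub_mul_le hc' (hne.image _) hA hε
  refine ⟨M, hM, ?_⟩
  rwa [hs, proj_orthogonal, proj_orthogonal, sub_sub_sub_cancel_left] at h

end ClosedSubmodule

open ClosedSubmodule Polynomial

omit [CompleteSpace H] in
theorem invariant_closure {A : H →L[ℂ] H} {S : Submodule ℂ H} (hS : ∀ x ∈ S, A x ∈ S) :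
    ∀ x ∈ S.closure, A x ∈ S.closure :=
  fun _ hx => map_mem_closure A.continuous hx hS

omit [CompleteSpace H] in
theorem invariant_sSup {A : H →L[ℂ] H} {c : Set (ClosedSubmodule ℂ H)}
    (hc : ∀ M ∈ c, ∀ x ∈ M, A x ∈ M) : ∀ x ∈ sSup c, A x ∈ sSup c := by
  have h : (⨆ M ∈ c, M.toSubmodule) ≤ (⨆ M ∈ c, M.toSubmodule).comap (A : H →ₗ[ℂ] H) :=
    iSup₂_le fun M hM x hx =>
      (le_iSup₂ (f := fun (M : ClosedSubmodule ℂ H) (_ : M ∈ c) => M.toSubmodule) M hM)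
        (hc M hM x hx)
  exact invariant_closure h

/-- **Zorn's lemma** for minimal elements of a nonempty set. -/
theorem exists_minimal_of_isChain_bddBelow {α : Type*} [Preorder α] {s : Set α} {x : α}
    (hx : x ∈ s) (h : ∀ c ⊆ s, IsChain (· ≤ ·) c → c.Nonempty → ∃ lb ∈ s, ∀ z ∈ c, lb ≤ z) :
    ∃ m, Minimal (· ∈ s) m := by
  obtain ⟨m, -, hm⟩ := zorn_le_nonempty₀ (α := αᵒᵈ) s
    (fun c hcs hc y hy => h c hcs hc.symm ⟨y, hy⟩) x hx
  exact ⟨m, hm⟩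

/-- Above every proper closed invariant subspace of a compact quasinilpotent operator there is a
strictly larger one such that the compression of the operator to the gap is small. -/
theorem exists_invariant_norm_gap_le {A : H →L[ℂ] H} (hA : IsCompactOperator A)
    (hq : ∀ ε : ℝ, 0 < ε → ∀ᶠ n : ℕ in atTop, ‖A ^ n‖ ≤ ε ^ n)
    {N : ClosedSubmodule ℂ H} (hN : ∀ x ∈ N, A x ∈ N) (hNt : N ≠ ⊤) {ε : ℝ} (hε : 0 < ε) :
    ∃ L : ClosedSubmodule ℂ H, N < L ∧ (∀ x ∈ L, A x ∈ L) ∧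
      ‖(L.proj - N.proj) * (A * (L.proj - N.proj))‖ ≤ ε := by
  by_contra! hcon
  have htop : (⊤ : ClosedSubmodule ℂ H) ∈ {L | N < L ∧ ∀ x ∈ L, A x ∈ L} :=
    ⟨lt_top_iff_ne_top.2 hNt, fun _ _ => by simp⟩
  obtain ⟨L, ⟨hNL, hL⟩, hmin⟩ := exists_minimal_of_isChain_bddBelow htop (fun c hcS hc hne => by
    refine ⟨sInf c, ⟨?_, ?_⟩, fun z hz => sInf_le hz⟩
    · refine lt_of_le_of_ne (le_sInf fun M hM => (hcS hM).1.le) ?_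
      intro heq
      obtain ⟨M, hM, hMε⟩ := exists_norm_proj_sub_sInf_mul_le hc hne hA hε
      refine (hcon M (hcS hM).1 (hcS hM).2).not_ge ?_
      rw [← heq] at hMε
      rw [← mul_assoc]
      exact (norm_mul_le _ _).trans
        ((mul_le_of_le_one_right (norm_nonneg _)
          (norm_proj_sub_proj_le (hcS hM).1.le)).trans hMε)
    · intro x hx
      rw [ClosedSubmodule.mem_sInf] at hx ⊢
      exact fun M hM => (hcS hM).2 x (hx M hM))
  have hmin' : ∀ K : ClosedSubmodule ℂ H, N < K → (∀ x ∈ K, A x ∈ K) → K ≤ L → L ≤ K :=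
    fun K h1 h2 h3 => hmin (y := K) ⟨h1, h2⟩ h3
  set Δ := L.proj - N.proj with hΔ
  have hΔN : Δ * N.proj = 0 := by
    rw [hΔ, sub_mul, proj_mul_proj_of_le hNL.le, proj_mul_proj_of_le le_rfl, sub_self]
  have hΔL : Δ * L.proj = Δ := by
    rw [hΔ, sub_mul, proj_mul_proj_of_le' hNL.le, proj_mul_proj_of_le le_rfl]
  have hLΔ : L.proj * Δ = Δ := by
    rw [hΔ, mul_sub, proj_mul_proj_of_le hNL.le, proj_mul_proj_of_le le_rfl]
  have hNΔ : N.proj * Δ = 0 := by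
    rw [hΔ, mul_sub, proj_mul_proj_of_le' hNL.le, proj_mul_proj_of_le le_rfl, sub_self]
  have hΔΔ : Δ * Δ = Δ := by
    nth_rw 2 [hΔ]
    rw [mul_sub, hΔL, hΔN, sub_zero]
  have hpow : ∀ n : ℕ, L.proj * (A ^ n * Δ) = A ^ n * Δ := fun n => by
    have hLn : ∀ n : ℕ, ∀ x ∈ L, (A ^ n) x ∈ L := fun n => by
      induction n with
      | zero => simp
      | succ n ih => intro x hx; rw [pow_succ']; exact hL _ (ih x hx)
    have := mul_proj_of_invariant (hLn n)
    calc L.proj * (A ^ n * Δ) = (L.proj * (A ^ n * L.proj)) * Δ := by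
          simp only [mul_assoc, hLΔ]
      _ = A ^ n * Δ := by rw [this, mul_assoc, hLΔ]
  set B := Δ * (A * Δ) with hBdef
  have hBΔ : B * Δ = B := by simp only [hBdef, mul_assoc, hΔΔ]
  have hB1 : B = Δ * (A * L.proj) := by
    have h0 : Δ * (A * N.proj) = 0 := by
      rw [← mul_proj_of_invariant hN, ← mul_assoc, hΔN, zero_mul]
    rw [hBdef]
    nth_rw 2 [hΔ]
    rw [mul_sub, mul_sub, h0, sub_zero]
  have hBpow : ∀ n : ℕ, B ^ n * Δ = Δ * (A ^ n * Δ) := fun n => by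
    induction n with
    | zero => simp [hΔΔ]
    | succ n ih =>
      calc B ^ (n + 1) * Δ = B * (Δ * (A ^ n * Δ)) := by rw [pow_succ', mul_assoc, ih]
        _ = B * Δ * (A ^ n * Δ) := (mul_assoc _ _ _).symm
        _ = Δ * (A * (L.proj * (A ^ n * Δ))) := by
          rw [hBΔ, hB1]; simp only [mul_assoc]
        _ = _ := by rw [hpow, pow_succ']; simp only [mul_assoc]
  have hBp : ∀ p : ℂ[X], aeval B p * Δ = Δ * (aeval A p * Δ) := fun p => by
    induction p using Polynomial.induction_on' with
    | add p q hp hq => simp only [map_add, add_mul, mul_add, hp, hq]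
    | monomial n a =>
      simp only [aeval_monomial, ← Algebra.smul_def, smul_mul_assoc, mul_smul_comm, hBpow]
  have hΔ1 : ‖Δ‖ ≤ 1 := norm_proj_sub_proj_le hNL.le
  have hqB : ∀ ε : ℝ, 0 < ε → ∀ᶠ n : ℕ in atTop, ‖B ^ n‖ ≤ ε ^ n := fun ε hε => by
    filter_upwards [hq ε hε, eventually_gt_atTop 0] with n hn hn0
    obtain ⟨m, rfl⟩ := Nat.exists_eq_succ_of_ne_zero hn0.ne'
    have h1 : B ^ (m + 1) = Δ * (A ^ (m + 1) * Δ) := by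
      rw [← hBpow, pow_succ, mul_assoc, hBΔ]
    rw [Nat.succ_eq_add_one] at hn ⊢
    rw [h1]
    calc ‖Δ * (A ^ (m + 1) * Δ)‖ ≤ ‖Δ‖ * (‖A ^ (m + 1)‖ * ‖Δ‖) :=
          (norm_mul_le _ _).trans (by gcongr; exact norm_mul_le _ _)
      _ ≤ 1 * (ε ^ (m + 1) * 1) := by gcongr
      _ = _ := by ring
  have hBc : IsCompactOperator B := (hA.comp_clm Δ).clm_comp Δ
  have hΔmem : ∀ x, Δ x ∈ L.toSubmodule ⊓ N.toSubmoduleᗮ := fun x =>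
    ⟨L.toSubmodule.sub_mem (L.proj_apply_mem x) (hNL.le (N.proj_apply_mem x)),
      proj_eq_zero_iff.1 (DFunLike.congr_fun hNΔ x)⟩
  have hΔself : ∀ x ∈ L.toSubmodule ⊓ N.toSubmoduleᗮ, Δ x = x := fun x hx => by
    rw [hΔ, sub_apply, proj_eq_self hx.1, proj_eq_zero_iff.2 hx.2, sub_zero]
  have hzero : ∀ x ∈ L.toSubmodule ⊓ N.toSubmoduleᗮ, B x = 0 := fun x hx => by
    refine eq_zero_of_forall_cyclic hBc hqB (fun x _ => hΔmem _)
      (L.isClosed.inter (Submodule.isClosed_orthogonal _)) ?_ hx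
    intro y hy hy0 z hz δ hδ
    let S : Submodule ℂ H := LinearMap.range
      ((ContinuousLinearMap.apply ℂ H y).toLinearMap ∘ₗ (aeval A (R := ℂ)).toLinearMap)
    have hSmem : ∀ p : ℂ[X], aeval A p y ∈ S := fun p => ⟨p, rfl⟩
    have hSA : ∀ x ∈ N.toSubmodule ⊔ S, A x ∈ N.toSubmodule ⊔ S := fun x hx => by
      obtain ⟨n, hn, _, ⟨p, rfl⟩, rfl⟩ := Submodule.mem_sup.1 hx
      rw [map_add]
      refine Submodule.add_mem_sup (hN n hn) ?_
      have := hSmem (X * p)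
      rwa [map_mul, aeval_X] at this
    have hyS : y ∈ S := by simpa using hSmem 1
    have hSL : S ≤ L.toSubmodule := by
      rintro _ ⟨p, rfl⟩
      change aeval A p y ∈ L
      induction p using Polynomial.induction_on' with
      | add p q hp hq => simpa using L.toSubmodule.add_mem hp hq
      | monomial n a =>
        rw [aeval_monomial, ← Algebra.smul_def]
        have h1 := DFunLike.congr_fun (hpow n) y
        simp only [mul_apply_eq_comp, hΔself y hy] at h1
        exact L.toSubmodule.smul_mem a (h1 ▸ L.proj_apply_mem _)
    have hle : L ≤ (N.toSubmodule ⊔ S).closure := by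
      refine hmin' _ (lt_of_le_of_ne ?_ ?_) (invariant_closure hSA)
        (Submodule.closure_le.2 (sup_le hNL.le hSL))
      · exact fun x hx => subset_closure (Submodule.mem_sup_left hx)
      · intro heq
        have hyN : y ∈ N := by
          rw [heq]
          exact subset_closure (Submodule.mem_sup_right hyS)
        exact hy0 ((proj_eq_self hyN).symm.trans (proj_eq_zero_iff.2 hy.2))
    obtain ⟨w, hw, hwz⟩ := Metric.mem_closure_iff.1 (hle hz.1) δ hδ
    obtain ⟨n, hn, _, ⟨p, rfl⟩, rfl⟩ := Submodule.mem_sup.1 hw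
    refine ⟨p, ?_⟩
    have h1 : Δ n = 0 := by
      have := DFunLike.congr_fun hΔN n
      rwa [mul_apply_eq_comp, proj_eq_self hn] at this
    have h2 : aeval B p y = Δ (aeval A p y) := by
      have := DFunLike.congr_fun (hBp p) y
      simpa only [mul_apply_eq_comp, hΔself y hy] using this
    have h3 : aeval B p y - z = Δ (n + aeval A p y - z) := by
      rw [map_sub, map_add, h1, zero_add, hΔself z hz, h2]
    rw [h3]
    refine lt_of_le_of_lt (Δ.le_of_opNorm_le hΔ1 _) ?_
    rw [one_mul, ← dist_eq_norm, dist_comm]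
    exact hwz
  have hB0 : B = 0 := by
    rw [← hBΔ]
    ext x
    exact hzero _ (hΔmem x)
  have := hcon L hNL hL
  rw [← hΔ, ← hBdef, hB0, norm_zero] at this
  exact this.not_ge hε.le

end Gap

section Approximation

open ClosedSubmodule

variable {H : Type*} [NormedAddCommGroup H] [InnerProductSpace ℂ H] [CompleteSpace H]

namespace ClosedSubmodule

theorem proj_mul_proj_sub_proj {M N : ClosedSubmodule ℂ H} (h : M ≤ N) :
    M.proj * (N.proj - M.proj) = 0 := by
  rw [mul_sub, proj_mul_proj_of_le' h, proj_mul_proj_of_le le_rfl, sub_self]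

theorem inner_proj_proj_sub_proj {M N : ClosedSubmodule ℂ H} (h : M ≤ N) (x y : H) :
    ⟪M.proj x, (N.proj - M.proj) y⟫_ℂ = 0 := by
  nth_rw 1 [← star_proj M]
  rw [star_eq_adjoint, adjoint_inner_left]
  have := DFunLike.congr_fun (proj_mul_proj_sub_proj h) y
  rw [mul_apply_eq_comp, zero_apply] at this
  rw [this, inner_zero_right]

/-- The norm of a block diagonal operator is bounded by the norms of its blocks. -/
theorem norm_add_le_of_block_diagonal {M N : ClosedSubmodule ℂ H} (h : M ≤ N) {D T : H →L[ℂ] H}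
    (hD : M.proj * D = D) (hD' : D * M.proj = D) (hT : (N.proj - M.proj) * T = T)
    (hT' : T * (N.proj - M.proj) = T) {ε : ℝ} (hDε : ‖D‖ ≤ ε) (hTε : ‖T‖ ≤ ε) :
    ‖D + T‖ ≤ ε := by
  have hε : 0 ≤ ε := (norm_nonneg _).trans hDε
  refine ContinuousLinearMap.opNorm_le_bound _ hε fun x => ?_
  have h1 : ‖D x + T x‖ * ‖D x + T x‖ = ‖D x‖ * ‖D x‖ + ‖T x‖ * ‖T x‖ := by
    refine norm_add_sq_eq_norm_sq_add_norm_sq_of_inner_eq_zero (𝕜 := ℂ) _ _ ?_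
    rw [← hD, ← hT]
    exact inner_proj_proj_sub_proj h _ _
  have h2 : ‖N.proj x‖ * ‖N.proj x‖ =
      ‖M.proj x‖ * ‖M.proj x‖ + ‖(N.proj - M.proj) x‖ * ‖(N.proj - M.proj) x‖ := by
    rw [← norm_add_sq_eq_norm_sq_add_norm_sq_of_inner_eq_zero (𝕜 := ℂ) _ _
      (inner_proj_proj_sub_proj h x x), sub_apply, add_sub_cancel]
  have h3 : ‖D x‖ ≤ ε * ‖M.proj x‖ := by
    nth_rw 1 [← hD']
    exact D.le_of_opNorm_le hDε _
  have h4 : ‖T x‖ ≤ ε * ‖(N.proj - M.proj) x‖ := by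
    nth_rw 1 [← hT']
    exact T.le_of_opNorm_le hTε _
  have h5 : ‖N.proj x‖ ≤ ‖x‖ := by simpa using N.proj.le_of_opNorm_le N.norm_proj_le x
  refine le_of_sq_le_sq ?_ (by positivity)
  rw [add_apply]
  calc ‖D x + T x‖ ^ 2 = ‖D x‖ ^ 2 + ‖T x‖ ^ 2 := by rw [sq, h1, sq, sq]
    _ ≤ (ε * ‖M.proj x‖) ^ 2 + (ε * ‖(N.proj - M.proj) x‖) ^ 2 := by gcongr
    _ = (ε * ‖N.proj x‖) ^ 2 := by rw [mul_pow, mul_pow, mul_pow, sq ‖N.proj x‖, h2]; ring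
    _ ≤ (ε * ‖x‖) ^ 2 := by gcongr

end ClosedSubmodule

variable {ι : Type*} (b : HilbertBasis ι ℂ H)

/-- The restriction of `A` to the invariant subspace `M` is within `ε` of an operator whose
Hilbert–Schmidt norm is at most that of the restriction of `A - A*` to `M`. -/
structure ApproxOn (A : H →L[ℂ] H) (ε : ℝ) (M : ClosedSubmodule ℂ H) : Prop where
  invariant : ∀ x ∈ M, A x ∈ M
  exists_approx : ∃ V : H →L[ℂ] H, V * M.proj = V ∧ M.proj * V = V ∧
    hilbertSchmidtSq b V ≤ hilbertSchmidtSq b ((A - star A) * M.proj) ∧ ‖A * M.proj - V‖ ≤ ε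

theorem approxOn_bot (A : H →L[ℂ] H) {ε : ℝ} (hε : 0 ≤ ε) : ApproxOn b A ε ⊥ where
  invariant x hx := by
    rw [ClosedSubmodule.mem_bot] at hx ⊢
    rw [hx, map_zero]
  exists_approx := ⟨0, by simp, by simp, by simp [hilbertSchmidtSq], by simpa [proj_bot] using hε⟩

variable {b}

theorem ApproxOn.of_gap {A : H →L[ℂ] H} {ε : ℝ} {M N : ClosedSubmodule ℂ H}
    (hM : ApproxOn b A ε M) (h : M ≤ N) (hN : ∀ x ∈ N, A x ∈ N)
    (hgap : ‖(N.proj - M.proj) * (A * (N.proj - M.proj))‖ ≤ ε) : ApproxOn b A ε N := by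
  obtain ⟨hMinv, V, hVM, hMV, hV, hVε⟩ := hM
  refine ⟨hN, V + M.proj * (A * (N.proj - M.proj)), ?_⟩
  have hMM : M.proj * M.proj = M.proj := proj_mul_proj_of_le le_rfl
  have hNN : N.proj * N.proj = N.proj := proj_mul_proj_of_le le_rfl
  have hMN : M.proj * N.proj = M.proj := proj_mul_proj_of_le' h
  have hNM : N.proj * M.proj = M.proj := proj_mul_proj_of_le h
  have hAM := mul_proj_of_invariant hMinv
  have hAN := mul_proj_of_invariant hN
  have hsM := M.star_proj
  set Δ := N.proj - M.proj with hΔ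
  have hsΔ : star Δ = Δ := by rw [hΔ, star_sub, star_proj, star_proj]
  have hMΔ : M.proj * Δ = 0 := proj_mul_proj_sub_proj h
  have hΔM : Δ * M.proj = 0 := by rw [hΔ, sub_mul, hNM, hMM, sub_self]
  have hΔN : Δ * N.proj = Δ := by rw [hΔ, sub_mul, hNN, hMN]
  have hNΔ : N.proj * Δ = Δ := by rw [hΔ, mul_sub, hNN, hNM]
  have hΔΔ : Δ * Δ = Δ := by
    nth_rw 2 [hΔ]
    rw [mul_sub, hΔN, hΔM, sub_zero]
  have hVΔ : V * Δ = 0 := by rw [← hVM, mul_assoc, hMΔ, mul_zero]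
  have hΔAM : Δ * (A * M.proj) = 0 := by rw [← hAM, ← mul_assoc, hΔM, zero_mul]
  have hMAΔ : M.proj * (star A * Δ) = 0 := by
    have := congr_arg star hΔAM
    rwa [star_mul, star_mul, hsM, hsΔ, star_zero, mul_assoc] at this
  have hsplit : N.proj = M.proj + Δ := (add_sub_cancel _ _).symm
  refine ⟨?_, ?_, ?_, ?_⟩
  · rw [add_mul, mul_assoc, mul_assoc, hΔN, ← hVM, mul_assoc, hMN]
  · rw [mul_add, ← mul_assoc, hNM, ← hMV, ← mul_assoc, hNM]
  · have h1 : V * star (M.proj * (A * Δ)) = 0 := by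
      rw [star_mul, star_mul, hsΔ, mul_assoc, ← mul_assoc, hVΔ, zero_mul]
    have h2 : M.proj * (A * Δ) = M.proj * ((A - star A) * Δ) := by
      rw [sub_mul A, mul_sub M.proj (A * Δ), hMAΔ, sub_zero]
    have h3 : (A - star A) * M.proj * star ((A - star A) * Δ) = 0 := by
      rw [star_mul, hsΔ, mul_assoc, ← mul_assoc M.proj, hMΔ, zero_mul, mul_zero]
    rw [hilbertSchmidtSq_add b h1, hsplit, mul_add, hilbertSchmidtSq_add b h3, h2]
    exact add_le_add hV (hilbertSchmidtSq_mul_le_left b M.norm_proj_le _)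
  · have h1 : A * Δ = M.proj * (A * Δ) + Δ * (A * Δ) := by
      rw [← add_mul, ← hsplit]
      calc A * Δ = A * N.proj * Δ := by rw [mul_assoc, hNΔ]
        _ = N.proj * (A * Δ) := by rw [← hAN]; simp only [mul_assoc, hNΔ]
    have h2 : A * N.proj - (V + M.proj * (A * Δ)) = (A * M.proj - V) + Δ * (A * Δ) := by
      rw [hsplit, mul_add]
      nth_rw 1 [h1]
      abel
    rw [h2]
    refine norm_add_le_of_block_diagonal h ?_ ?_ ?_ ?_ hVε hgap
    · rw [mul_sub, hAM, hMV]
    · rw [sub_mul, mul_assoc, hMM, hVM]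
    · rw [← hΔ, ← mul_assoc, hΔΔ]
    · rw [← hΔ, mul_assoc, mul_assoc, hΔΔ]

theorem approxOn_top {A : H →L[ℂ] H} (hA : IsCompactOperator A)
    (hq : ∀ ε : ℝ, 0 < ε → ∀ᶠ n : ℕ in atTop, ‖A ^ n‖ ≤ ε ^ n) {ε : ℝ} (hε : 0 < ε) :
    ApproxOn b A ε ⊤ := by
  obtain ⟨M, -, hM⟩ := zorn_le_nonempty₀ {M | ApproxOn b A ε M} (fun c hcs hc y hy => by
    obtain ⟨M, hMc, hMε⟩ := exists_norm_proj_sSup_sub_mul_le hc ⟨y, hy⟩ hA hε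
    have hle : M ≤ sSup c := le_sSup hMc
    refine ⟨sSup c, (hcs hMc).of_gap hle (invariant_sSup fun M hM => (hcs hM).invariant) ?_,
      fun z hz => le_sSup hz⟩
    rw [← mul_assoc]
    exact (norm_mul_le _ _).trans ((mul_le_of_le_one_right (norm_nonneg _)
      (norm_proj_sub_proj_le hle)).trans hMε)) ⊥ (approxOn_bot b A hε.le)
  by_cases hMt : M = ⊤
  · exact hMt ▸ hM.prop
  · obtain ⟨L, hML, hL, hgap⟩ := exists_invariant_norm_gap_le hA hq hM.prop.invariant hMt hε
    exact absurd (hM.le_of_ge (hM.prop.of_gap hML.le hL hgap) hML.le) hML.not_ge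

/-- The Hilbert–Schmidt norm of a compact quasinilpotent operator `A` is bounded by that of
`A - A*`. -/
theorem hilbertSchmidtSq_le_of_quasinilpotent {A : H →L[ℂ] H} (hA : IsCompactOperator A)
    (hq : ∀ ε : ℝ, 0 < ε → ∀ᶠ n : ℕ in atTop, ‖A ^ n‖ ≤ ε ^ n) :
    hilbertSchmidtSq b A ≤ hilbertSchmidtSq b (A - star A) := by
  refine hilbertSchmidtSq_le_of_forall_exists b fun ε hε => ?_
  obtain ⟨-, V, -, -, hV, hVε⟩ := approxOn_top (b := b) hA hq hε
  rw [proj_top, mul_one] at hV hVε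
  exact ⟨V, hV, hVε⟩

end Approximation

/-- Corollary 8.12/8.13: if the spectrum of a bounded operator `A` on a complex
separable Hilbert space consists only of zero and the imaginary part
`Im(A) = (A - A*)/(2i)` is Hilbert–Schmidt, then the real part
`Re(A) = (A + A*)/2` is Hilbert–Schmidt as well; equivalently, `A` itself is
Hilbert–Schmidt.  (Hilbert–Schmidt: for some, equivalently every, Hilbert
basis `(eᵢ)`, `Σᵢ ‖·eᵢ‖² < ∞`.) -/
theorem stmt_14 {H : Type*} [NormedAddCommGroup H] [InnerProductSpace ℂ H]
    [CompleteSpace H] [TopologicalSpace.SeparableSpace H]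
    (A : H →L[ℂ] H) (hspec : spectrum ℂ A = {0})
    (hHS : ∃ (s : Set H) (e : HilbertBasis s ℂ H),
      Summable fun i => ‖(((2 * Complex.I)⁻¹ : ℂ) • (A - adjoint A)) (e i)‖ ^ 2) :
    (∃ (s : Set H) (e : HilbertBasis s ℂ H),
      Summable fun i => ‖(((2 : ℂ)⁻¹ : ℂ) • (A + adjoint A)) (e i)‖ ^ 2) ∧
    (∃ (s : Set H) (e : HilbertBasis s ℂ H),
      Summable fun i => ‖A (e i)‖ ^ 2) := by
  obtain ⟨s, e, hs⟩ := hHS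
  have hG : hilbertSchmidtSq e (A - star A) ≠ ∞ := by
    rw [hilbertSchmidtSq_ne_top_iff, star_eq_adjoint]
    refine (hs.mul_left 4).congr fun i => ?_
    rw [smul_apply, norm_smul, mul_pow]
    norm_num
    ring
  have hq := fun ε hε => eventually_norm_pow_le_of_spectralRadius_eq_zero
    (spectralRadius_eq_zero_of_spectrum_eq hspec) (ε := ε) hε
  have hcomp : IsCompactOperator A := by
    refine isCompactOperator_of_quasinilpotent_of_sub_compact (R := (2⁻¹ : ℂ) • (A + star A)) hq
      ?_ ?_
    · rw [isSelfAdjoint_iff, star_smul, star_add, star_star, add_comm]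
      simp
    · have h : (2⁻¹ : ℂ) • (A + star A) - A = (-2⁻¹ : ℂ) • (A - star A) := by module
      rw [h]
      exact (isCompactOperator_of_hilbertSchmidtSq_ne_top e hG).smul _
  have hA : hilbertSchmidtSq e A ≠ ∞ :=
    ne_top_of_le_ne_top hG (hilbertSchmidtSq_le_of_quasinilpotent hcomp hq)
  have hA' : hilbertSchmidtSq e (star A) ≠ ∞ := by rwa [hilbertSchmidtSq_star]
  rw [hilbertSchmidtSq_ne_top_iff] at hA hA'
  refine ⟨⟨s, e, (hA.add hA').of_nonneg_of_le (fun _ => by positivity) fun i => ?_⟩, s, e, hA⟩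
  rw [smul_apply, add_apply, norm_smul, star_eq_adjoint]
  have h := norm_add_le (A (e i)) (adjoint A (e i))
  norm_num
  nlinarith [sq_nonneg (‖A (e i)‖ - ‖adjoint A (e i)‖), norm_nonneg (A (e i) + adjoint A (e i)),
    norm_nonneg (A (e i)), norm_nonneg (adjoint A (e i))]
end

section
/- Let ℓ > 0 and α ∈ ℝ, and let A be the bounded operator on L²(0, ℓ) defined by (Af)(x) = x f(x) + iα ∫₀ˣ f(t) dt. Then there exist bounded operators B and C on L²(0, ℓ) with BC = CB = I such that for every f ∈ L²(0, ℓ) and almost every x ∈ (0, ℓ): ∫₀ˣ (Bf)(t) dt = (1/Γ(1 + iα)) ∫₀ˣ (x − t)^{iα} f(t) dt and ∫₀ˣ (Cf)(t) dt = (1/Γ(1 − iα)) ∫₀ˣ (x − t)^{−iα} f(t) dt, and such that B A = Q B, i.e., A = C Q B, where Q is the multiplication operator (Qf)(x) = x f(x). Thus A is similar to the multiplication operator Q. -/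
open MeasureTheory ContinuousLinearMap
open Set Filter Topology FourierTransform SchwartzMap ComplexConjugate
open scoped ENNReal

theorem integrableOn_rpow_mul_exp_neg_mul_Ioi {s b : ℝ} (hs : -1 < s) (hb : 0 < b) :
    IntegrableOn (fun t : ℝ => t ^ s * Real.exp (-(b * t))) (Ioi 0) := by
  simpa using integrableOn_rpow_mul_exp_neg_mul_rpow (s := s) (p := 1) hs one_pos hb

theorem norm_cpow_mul_exp_neg_mul {a r : ℂ} {t : ℝ} (ht : 0 < t) :
    ‖(t : ℂ) ^ a * Complex.exp (-(r * t))‖ = t ^ a.re * Real.exp (-(r.re * t)) := by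
  rw [norm_mul, Complex.norm_cpow_eq_rpow_re_of_pos ht, Complex.norm_exp]
  simp

theorem integrableOn_cpow_mul_exp_neg_mul_Ioi {a r : ℂ} (ha : -1 < a.re) (hr : 0 < r.re) :
    IntegrableOn (fun t : ℝ => (t : ℂ) ^ a * Complex.exp (-(r * t))) (Ioi 0) := by
  refine (integrableOn_rpow_mul_exp_neg_mul_Ioi ha hr).mono' ?_ ?_
  · refine ContinuousOn.aestronglyMeasurable (fun t ht => ?_) measurableSet_Ioi
    refine ContinuousAt.continuousWithinAt ?_
    refine ContinuousAt.mul ?_ (by fun_prop)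
    exact Complex.continuousAt_ofReal_cpow_const _ _ (Or.inr (ne_of_gt ht))
  · filter_upwards [ae_restrict_mem measurableSet_Ioi] with t ht
    rw [norm_cpow_mul_exp_neg_mul ht]

theorem differentiableOn_integral_cpow_mul_exp_neg_mul {a : ℂ} (ha : -1 < a.re) :
    DifferentiableOn ℂ
      (fun r : ℂ => ∫ t : ℝ in Ioi 0, (t : ℂ) ^ a * Complex.exp (-(r * t)))
      {r : ℂ | 0 < r.re} := by
  intro r₀ hr₀
  have hr₀' : 0 < r₀.re := hr₀
  have key := hasDerivAt_integral_of_dominated_loc_of_deriv_le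
    (μ := volume.restrict (Ioi (0 : ℝ))) (x₀ := r₀)
    (s := {r : ℂ | r₀.re / 2 < r.re})
    (F := fun (r : ℂ) (t : ℝ) => (t : ℂ) ^ a * Complex.exp (-(r * t)))
    (F' := fun (r : ℂ) (t : ℝ) => (t : ℂ) ^ a * (Complex.exp (-(r * t)) * -(t : ℂ)))
    (bound := fun t : ℝ => t ^ (a.re + 1) * Real.exp (-(r₀.re / 2 * t)))
    ((isOpen_lt continuous_const Complex.continuous_re).mem_nhds (by simp; linarith))
    ?_ ?_ ?_ ?_ ?_ ?_
  · exact key.2.differentiableAt.differentiableWithinAt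
  · filter_upwards [(isOpen_lt continuous_const Complex.continuous_re).mem_nhds hr₀'] with r hr
    exact (integrableOn_cpow_mul_exp_neg_mul_Ioi ha hr).aestronglyMeasurable
  · exact integrableOn_cpow_mul_exp_neg_mul_Ioi ha hr₀'
  · have := (integrableOn_cpow_mul_exp_neg_mul_Ioi ha hr₀').aestronglyMeasurable.mul
      (f := fun t : ℝ => (t : ℂ) ^ a * Complex.exp (-(r₀ * t))) (g := fun t : ℝ => -(t : ℂ))
      (by fun_prop)
    refine this.congr (.of_forall fun t => ?_)
    simp only [Pi.mul_apply]
    ring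
  · filter_upwards [ae_restrict_mem measurableSet_Ioi] with t ht r hr
    have ht' : 0 < t := ht
    rw [← mul_assoc, norm_mul, norm_cpow_mul_exp_neg_mul ht, norm_neg, Complex.norm_real,
      Real.norm_of_nonneg ht'.le, Real.rpow_add_one ht'.ne', mul_right_comm]
    have hr' : r₀.re / 2 < r.re := hr
    gcongr
  · exact integrableOn_rpow_mul_exp_neg_mul_Ioi (by linarith) (by linarith)
  · refine .of_forall fun t r _ => ?_
    have h : HasDerivAt (fun r : ℂ => -(r * t)) (-(t : ℂ)) r := by
      simpa using ((hasDerivAt_id r).mul_const (t : ℂ)).fun_neg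
    exact (h.cexp).const_mul _

theorem integral_cpow_mul_exp_neg_complex_mul_Ioi {a r : ℂ} (ha : 0 < a.re) (hr : 0 < r.re) :
    ∫ t : ℝ in Ioi 0, (t : ℂ) ^ (a - 1) * Complex.exp (-(r * t)) = r ^ (-a) * Complex.Gamma a := by
  have hopen : IsOpen {r : ℂ | 0 < r.re} := isOpen_lt continuous_const Complex.continuous_re
  have h1 := (differentiableOn_integral_cpow_mul_exp_neg_mul (a := a - 1)
    (by simpa using ha)).analyticOnNhd hopen
  have h2 : AnalyticOnNhd ℂ (fun r : ℂ => r ^ (-a) * Complex.Gamma a) {r : ℂ | 0 < r.re} := by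
    refine DifferentiableOn.analyticOnNhd (fun r hr => ?_) hopen
    refine DifferentiableAt.differentiableWithinAt ?_
    refine DifferentiableAt.mul_const ?_ _
    exact differentiableAt_id.cpow (differentiableAt_const _) (Or.inl hr)
  have hconn : IsPreconnected {r : ℂ | 0 < r.re} := (convex_halfSpace_re_gt 0).isPreconnected
  refine h1.eqOn_of_preconnected_of_frequently_eq h2 hconn (z₀ := 1) (by simp) ?_ hr
  have hseq : Tendsto (fun n : ℕ => ((1 + 1 / ((n : ℝ) + 1) : ℝ) : ℂ)) atTop (𝓝[≠] 1) := by
    refine tendsto_nhdsWithin_iff.mpr ⟨?_, .of_forall fun n => ?_⟩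
    · have := (tendsto_one_div_add_atTop_nhds_zero_nat (𝕜 := ℝ)).const_add 1
      rw [add_zero] at this
      exact (Complex.continuous_ofReal.tendsto' _ _ Complex.ofReal_one).comp this
    · have : (0 : ℝ) < 1 / ((n : ℝ) + 1) := by positivity
      simp only [mem_compl_iff, mem_singleton_iff]
      rw [Complex.ofReal_eq_one]
      linarith
  refine hseq.frequently (Frequently.of_forall fun n => ?_)
  set x : ℝ := 1 + 1 / ((n : ℝ) + 1) with hx
  have hx0 : 0 < x := by positivity
  rw [Complex.integral_cpow_mul_exp_neg_mul_Ioi ha hx0, one_div, Complex.inv_cpow,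
    Complex.cpow_neg]
  rw [Complex.arg_ofReal_of_nonneg hx0.le]
  exact Real.pi_pos.ne

theorem Lp_fourier_ae_eq_of_integrable (f : Lp ℂ 2 (volume : Measure ℝ)) (hf : Integrable f volume)
    (hcont : Continuous (𝓕 (f : ℝ → ℂ))) :
    ((𝓕 f : Lp ℂ 2 (volume : Measure ℝ)) : ℝ → ℂ) =ᵐ[volume] 𝓕 (f : ℝ → ℂ) := by
  refine ae_eq_of_integral_contDiff_smul_eq
    ((Lp.memLp _).locallyIntegrable (by norm_num)) hcont.locallyIntegrable
    fun g hg hgc => ?_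
  let φ : 𝓢(ℝ, ℂ) := HasCompactSupport.toSchwartzMap (f := fun x => (g x : ℂ))
    (hgc.comp_left (g := ((↑) : ℝ → ℂ)) (by simp)) (Complex.ofRealCLM.contDiff.comp hg)
  have h := congrArg (fun T : 𝓢'(ℝ, ℂ) => T φ) (Lp.fourier_toTemperedDistribution_eq f)
  simp only [TemperedDistribution.fourier_apply, Lp.toTemperedDistribution_apply] at h
  have h2 := VectorFourier.integral_fourierIntegral_smul_eq_flip (L := innerₗ ℝ)
    (μ := volume) (ν := volume) (e := Real.fourierChar)
    (f := φ) (g := (f : ℝ → ℂ)) Real.continuous_fourierChar continuous_inner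
    φ.integrable hf
  rw [flip_innerₗ] at h2
  have e1 : ∀ x, φ x = (g x : ℂ) := fun x => rfl
  calc _ = ∫ x, φ x • ((𝓕 f : Lp ℂ 2 (volume : Measure ℝ)) : ℝ → ℂ) x := by simp [e1]
    _ = _ := h.symm
    _ = _ := h2
    _ = _ := by simp [e1]; rfl

theorem exists_mulCLM {X : Type*} [MeasurableSpace X] {μ : Measure X} {m : X → ℂ}
    (hm : MemLp m ∞ μ) :
    ∃ M : Lp ℂ 2 μ →L[ℂ] Lp ℂ 2 μ, ∀ f : Lp ℂ 2 μ, M f =ᵐ[μ] fun x => m x * f x := by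
  refine ⟨(ContinuousLinearMap.mul ℂ ℂ).holderL μ ∞ 2 2 (hm.toLp m), fun f => ?_⟩
  filter_upwards [(ContinuousLinearMap.mul ℂ ℂ).coeFn_holder (r := 2) (hm.toLp m) f,
    hm.coeFn_toLp] with x h1 h2
  rw [← h2]
  exact h1

theorem exists_extendCLM {X : Type*} [MeasurableSpace X] {μ : Measure X} {s : Set X}
    (hs : MeasurableSet s) :
    ∃ E : Lp ℂ 2 (μ.restrict s) →L[ℂ] Lp ℂ 2 μ, ∀ f : Lp ℂ 2 (μ.restrict s),
      E f =ᵐ[μ] s.indicator f := by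
  have hmem (f : Lp ℂ 2 (μ.restrict s)) : MemLp (s.indicator f) 2 μ :=
    (memLp_indicator_iff_restrict hs).mpr (Lp.memLp f)
  have hae {f g : X → ℂ} (h : f =ᵐ[μ.restrict s] g) : s.indicator f =ᵐ[μ] s.indicator g :=
    (ae_eq_restrict_iff_indicator_ae_eq hs).mp h
  let E : Lp ℂ 2 (μ.restrict s) →ₗ[ℂ] Lp ℂ 2 μ :=
    { toFun := fun f => (hmem f).toLp _
      map_add' := fun f g => by
        rw [← MemLp.toLp_add]
        refine MemLp.toLp_congr _ _ ((hae (Lp.coeFn_add f g)).trans ?_)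
        rw [indicator_add']
      map_smul' := fun c f => by
        rw [RingHom.id_apply, ← MemLp.toLp_const_smul]
        refine MemLp.toLp_congr _ _ ((hae (Lp.coeFn_smul c f)).trans ?_)
        refine .of_forall fun x => ?_
        exact congrFun (indicator_const_smul s c f) x }
  refine ⟨E.mkContinuous 1 fun f => ?_, fun f => (hmem f).coeFn_toLp⟩
  rw [one_mul]
  simp only [E, LinearMap.coe_mk, AddHom.coe_mk, Lp.norm_toLp]
  rw [eLpNorm_indicator_eq_eLpNorm_restrict hs, Lp.norm_def]

/-- The convolution kernel whose Fourier transform is `(1 + 2πiξ) ^ (-(1 + β))`. -/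
noncomputable def gammaKernel (β : ℂ) : ℝ → ℂ :=
  (Ioi 0).indicator fun s => (s : ℂ) ^ β * Complex.exp (-s) / Complex.Gamma (1 + β)

theorem integrable_gammaKernel {β : ℂ} (hβ : -1 < β.re) : Integrable (gammaKernel β) := by
  refine (integrable_indicator_iff measurableSet_Ioi).mpr (Integrable.div_const ?_ _)
  simpa [IntegrableOn] using
    integrableOn_cpow_mul_exp_neg_mul_Ioi (r := 1) hβ (by simp)

theorem memLp_two_gammaKernel {β : ℂ} (hβ : -1 / 2 < β.re) : MemLp (gammaKernel β) 2 := by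
  rw [memLp_two_iff_integrable_sq_norm
    (integrable_gammaKernel (by linarith)).aestronglyMeasurable]
  have h : Integrable ((Ioi (0 : ℝ)).indicator fun s : ℝ =>
      s ^ (2 * β.re) * Real.exp (-(2 * s)) / ‖Complex.Gamma (1 + β)‖ ^ 2) :=
    (integrable_indicator_iff measurableSet_Ioi).mpr
      ((integrableOn_rpow_mul_exp_neg_mul_Ioi (by linarith) two_pos).div_const _)
  refine h.congr (.of_forall fun s => ?_)
  by_cases hs : 0 < s
  · have := norm_cpow_mul_exp_neg_mul (a := β) (r := 1) hs
    rw [one_mul] at this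
    simp only [gammaKernel, indicator_of_mem (mem_Ioi.mpr hs), norm_div, this]
    rw [div_pow, mul_pow, ← Real.rpow_mul_natCast hs.le, ← Real.exp_nat_mul]
    congr 3 <;> simp; ring
  · simp [gammaKernel, hs]

theorem conj_gammaKernel (β : ℂ) (s : ℝ) :
    conj (gammaKernel β s) = gammaKernel (conj β) s := by
  by_cases hs : 0 < s
  · have harg : (s : ℂ).arg ≠ Real.pi := by
      rw [Complex.arg_ofReal_of_nonneg hs.le]; exact Real.pi_pos.ne
    simp only [gammaKernel, indicator_of_mem (mem_Ioi.mpr hs), map_div₀, map_mul,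
      ← Complex.exp_conj, ← Complex.Gamma_conj, map_neg, map_add, map_one, Complex.conj_ofReal]
    rw [Complex.cpow_conj _ _ harg, Complex.conj_ofReal]
  · simp [gammaKernel, hs]

theorem fourier_gammaKernel_sub_left {β : ℂ} (hβ : -1 < β.re) (x ξ : ℝ) :
    𝓕 (fun t : ℝ => gammaKernel β (x - t)) ξ =
      Complex.exp (-(2 * Real.pi * Complex.I * x * ξ)) *
        (1 - 2 * Real.pi * Complex.I * ξ) ^ (-(1 + β)) := by
  have hre : 0 < (1 - 2 * Real.pi * Complex.I * ξ : ℂ).re := by simp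
  have hβ' : 0 < (1 + β).re := by simp; linarith
  have hΓ : Complex.Gamma (1 + β) ≠ 0 := Complex.Gamma_ne_zero_of_re_pos hβ'
  rw [Real.fourier_real_eq_integral_exp_smul,
    ← integral_sub_left_eq_self _ _ x]
  have key := integral_cpow_mul_exp_neg_complex_mul_Ioi hβ' hre
  rw [add_sub_cancel_left] at key
  rw [eq_comm, ← eq_div_iff hΓ] at key
  rw [key, ← integral_div, ← integral_const_mul, ← integral_indicator measurableSet_Ioi]
  refine integral_congr_ae (.of_forall fun s => ?_)
  by_cases hs : 0 < s
  · simp only [gammaKernel, sub_sub_cancel, indicator_of_mem (mem_Ioi.mpr hs), smul_eq_mul]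
    have : Complex.exp (↑(-2 * Real.pi * (x - s) * ξ) * Complex.I) * Complex.exp (-s)
      = Complex.exp (-(2 * Real.pi * Complex.I * x * ξ)) *
        Complex.exp (-((1 - 2 * Real.pi * Complex.I * ξ) * s)) := by
      rw [← Complex.exp_add, ← Complex.exp_add]
      congr 1
      push_cast
      ring
    linear_combination (s : ℂ) ^ β / Complex.Gamma (1 + β) * this
  · simp [gammaKernel, hs]

theorem memLp_two_gammaKernel_sub_left {β : ℂ} (hβ : -1 / 2 < β.re) (x : ℝ) :
    MemLp (fun t : ℝ => gammaKernel β (x - t)) 2 :=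
  (memLp_two_gammaKernel hβ).comp_measurePreserving (Measure.measurePreserving_sub_left _ x)

theorem fourier_toLp_gammaKernel {β : ℂ} (hβ : -1 / 2 < β.re) (x : ℝ) :
    ((𝓕 ((memLp_two_gammaKernel_sub_left hβ x).toLp _) : Lp ℂ 2 (volume : Measure ℝ)) : ℝ → ℂ)
      =ᵐ[volume] fun ξ : ℝ => Complex.exp (-(2 * Real.pi * Complex.I * x * ξ)) *
        (1 - 2 * Real.pi * Complex.I * ξ) ^ (-(1 + β)) := by
  have hβ' : -1 < β.re := by linarith
  have hint : Integrable (fun t : ℝ => gammaKernel β (x - t)) :=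
    (integrable_gammaKernel hβ').comp_sub_left x
  have hcoe := (memLp_two_gammaKernel_sub_left hβ x).coeFn_toLp
  have h : 𝓕 (((memLp_two_gammaKernel_sub_left hβ x).toLp _ :
      Lp ℂ 2 (volume : Measure ℝ)) : ℝ → ℂ) = fun ξ : ℝ =>
        Complex.exp (-(2 * Real.pi * Complex.I * x * ξ)) *
        (1 - 2 * Real.pi * Complex.I * ξ) ^ (-(1 + β)) := by
    funext ξ
    rw [Real.fourier_congr_ae hcoe, fourier_gammaKernel_sub_left hβ']
  rw [← h]
  refine Lp_fourier_ae_eq_of_integrable _ (hint.congr hcoe.symm) ?_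
  rw [h]
  refine Continuous.mul (by fun_prop) ?_
  refine Continuous.cpow (by fun_prop) continuous_const fun ξ => Or.inl ?_
  simp

theorem memLp_top_fourierSymbol {β : ℂ} (hβ : β.re = 0) :
    MemLp (fun ξ : ℝ => (1 + 2 * Real.pi * Complex.I * ξ : ℂ) ^ (-β)) ∞ := by
  refine memLp_top_of_bound (Continuous.aestronglyMeasurable ?_) (Real.exp (Real.pi * |β.im|))
    (.of_forall fun ξ => ?_)
  · refine Continuous.cpow (by fun_prop) continuous_const fun ξ => Or.inl ?_
    simp
  · refine (Complex.norm_cpow_le _ _).trans ?_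
    rw [Complex.neg_re, hβ, neg_zero, Real.rpow_zero, one_div, ← Real.exp_neg]
    refine Real.exp_le_exp.mpr ((le_abs_self _).trans ?_)
    rw [abs_neg, abs_mul, Complex.neg_im, abs_neg]
    gcongr
    exact Complex.abs_arg_le_pi _

/-- `T` acts on `L²(ℝ)` as the Fourier multiplier with symbol `m`. -/
def IsFourierMultiplier (m : ℝ → ℂ)
    (T : Lp ℂ 2 (volume : Measure ℝ) →L[ℂ] Lp ℂ 2 (volume : Measure ℝ)) : Prop :=
  ∀ g : Lp ℂ 2 (volume : Measure ℝ), ((𝓕 (T g) : Lp ℂ 2 (volume : Measure ℝ)) : ℝ → ℂ)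
    =ᵐ[volume] fun ξ => m ξ * (𝓕 g : Lp ℂ 2 (volume : Measure ℝ)) ξ

theorem exists_isFourierMultiplier {m : ℝ → ℂ} (hm : MemLp m ∞) :
    ∃ T : Lp ℂ 2 (volume : Measure ℝ) →L[ℂ] Lp ℂ 2 (volume : Measure ℝ),
      IsFourierMultiplier m T := by
  obtain ⟨M, hM⟩ := exists_mulCLM hm
  let F := Lp.fourierTransformₗᵢ ℝ ℂ
  refine ⟨F.symm.toContinuousLinearEquiv.toContinuousLinearMap ∘L M ∘L
    F.toContinuousLinearEquiv.toContinuousLinearMap, fun g => ?_⟩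
  have h : (𝓕 (F.symm (M (F g))) : Lp ℂ 2 (volume : Measure ℝ)) = M (F g) :=
    F.apply_symm_apply _
  have h' := hM (F g)
  rw [← h] at h'
  exact h'

theorem fourierMultiplier_leftInverse {β : ℂ}
    {T T' : Lp ℂ 2 (volume : Measure ℝ) →L[ℂ] Lp ℂ 2 (volume : Measure ℝ)}
    (hT : IsFourierMultiplier (fun ξ : ℝ => (1 + 2 * Real.pi * Complex.I * ξ : ℂ) ^ (-β)) T)
    (hT' : IsFourierMultiplier (fun ξ : ℝ => (1 + 2 * Real.pi * Complex.I * ξ : ℂ) ^ β) T')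
    (g : Lp ℂ 2 (volume : Measure ℝ)) :
    T' (T g) = g := by
  have hinj : Function.Injective
      (𝓕 : Lp ℂ 2 (volume : Measure ℝ) → Lp ℂ 2 (volume : Measure ℝ)) :=
    (Lp.fourierTransformₗᵢ ℝ ℂ).injective
  refine hinj (Lp.ext ?_)
  filter_upwards [hT g, hT' (T g)] with ξ h1 h2
  rw [h2, h1, ← mul_assoc, ← Complex.cpow_add, add_neg_cancel, Complex.cpow_zero, one_mul]
  · intro h
    simpa using congrArg Complex.re h

theorem integral_gammaKernel_mul_fourierMultiplier {β : ℂ} (hβ : β.re = 0)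
    {T : Lp ℂ 2 (volume : Measure ℝ) →L[ℂ] Lp ℂ 2 (volume : Measure ℝ)}
    (hT : IsFourierMultiplier (fun ξ : ℝ => (1 + 2 * Real.pi * Complex.I * ξ : ℂ) ^ (-β)) T)
    (g : Lp ℂ 2 (volume : Measure ℝ)) (x : ℝ) :
    ∫ t, gammaKernel 0 (x - t) * T g t = ∫ t, gammaKernel β (x - t) * g t := by
  have hinner {γ : ℂ} (hγ : -1 / 2 < γ.re) (h : Lp ℂ 2 (volume : Measure ℝ)) :
      ∫ t, gammaKernel (conj γ) (x - t) * h t =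
        inner ℂ ((memLp_two_gammaKernel_sub_left hγ x).toLp _) h := by
    rw [L2.inner_def]
    refine integral_congr_ae ?_
    filter_upwards [(memLp_two_gammaKernel_sub_left hγ x).coeFn_toLp] with t ht
    rw [ht, RCLike.inner_apply, conj_gammaKernel, mul_comm]
  have h0 : -1 / 2 < (0 : ℂ).re := by norm_num
  have hb : -1 / 2 < (conj β).re := by rw [Complex.conj_re, hβ]; norm_num
  have e1 := hinner h0 (T g)
  have e2 := hinner hb g
  rw [map_zero] at e1
  rw [Complex.conj_conj] at e2
  rw [e1, e2, ← Lp.inner_fourier_eq, ← Lp.inner_fourier_eq (_ : Lp ℂ 2 (volume : Measure ℝ)) g,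
    L2.inner_def, L2.inner_def]
  refine integral_congr_ae ?_
  filter_upwards [hT g, fourier_toLp_gammaKernel h0 x, fourier_toLp_gammaKernel hb x]
    with ξ h1 h2 h3
  rw [h1, h2, h3, RCLike.inner_apply, RCLike.inner_apply]
  have hw : (1 - 2 * Real.pi * Complex.I * ξ : ℂ) ≠ 0 := by
    intro h
    simpa using congrArg Complex.re h
  have harg : (1 - 2 * Real.pi * Complex.I * ξ : ℂ).arg ≠ Real.pi := by
    intro h
    have := (Complex.arg_eq_pi_iff.mp h).1
    norm_num at this
  have hc : conj ((1 - 2 * Real.pi * Complex.I * ξ : ℂ) ^ (-conj β)) =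
      (1 + 2 * Real.pi * Complex.I * ξ : ℂ) ^ (-β) := by
    have := Complex.cpow_conj (1 - 2 * Real.pi * Complex.I * ξ : ℂ) (-β) harg
    rw [map_neg] at this
    rw [this, Complex.conj_conj]
    simp [Complex.conj_ofNat]
  rw [← hc, neg_add, neg_add, Complex.cpow_add _ _ hw, Complex.cpow_add _ _ hw, neg_zero,
    Complex.cpow_zero]
  simp only [map_mul, map_one]
  ring

theorem integral_gammaKernel_sub_left_mul (β : ℂ) (g : ℝ → ℂ) (x : ℝ) :
    ∫ t, gammaKernel β (x - t) * g t =
      Complex.exp (-x) * ((1 / Complex.Gamma (1 + β)) *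
        ∫ t in Iio x, ((x - t : ℝ) : ℂ) ^ β * (Complex.exp t * g t)) := by
  rw [← integral_const_mul, ← integral_const_mul, ← integral_indicator measurableSet_Iio]
  refine integral_congr_ae (.of_forall fun t => ?_)
  by_cases ht : t < x
  · have hs : 0 < x - t := sub_pos.mpr ht
    simp only [gammaKernel, indicator_of_mem (mem_Ioi.mpr hs), indicator_of_mem (mem_Iio.mpr ht)]
    have : Complex.exp (-((x - t : ℝ) : ℂ)) = Complex.exp (-x) * Complex.exp t := by
      rw [← Complex.exp_add]
      congr 1
      push_cast
      ring
    rw [this]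
    ring
  · simp [gammaKernel, ht]

theorem setIntegral_Iio_exp_mul_fourierMultiplier {β : ℂ} (hβ : β.re = 0)
    {T : Lp ℂ 2 (volume : Measure ℝ) →L[ℂ] Lp ℂ 2 (volume : Measure ℝ)}
    (hT : IsFourierMultiplier (fun ξ : ℝ => (1 + 2 * Real.pi * Complex.I * ξ : ℂ) ^ (-β)) T)
    (g : Lp ℂ 2 (volume : Measure ℝ)) (x : ℝ) :
    ∫ t in Iio x, Complex.exp t * T g t = (1 / Complex.Gamma (1 + β)) *
      ∫ t in Iio x, ((x - t : ℝ) : ℂ) ^ β * (Complex.exp t * g t) := by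
  have h := integral_gammaKernel_mul_fourierMultiplier hβ hT g x
  rw [integral_gammaKernel_sub_left_mul, integral_gammaKernel_sub_left_mul] at h
  simpa using mul_left_cancel₀ (Complex.exp_ne_zero _) h

theorem integrableOn_Iio_exp_mul (g : Lp ℂ 2 (volume : Measure ℝ)) (x : ℝ) :
    IntegrableOn (fun t : ℝ => Complex.exp t * g t) (Iio x) := by
  have h : MemLp (fun t : ℝ => Complex.exp (-x) * (Complex.exp t)) 2 (volume.restrict (Iio x)) := by
    have := memLp_two_gammaKernel_sub_left (β := 0) (by norm_num) x
    refine (this.restrict (Iio x)).ae_eq ?_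
    filter_upwards [ae_restrict_mem measurableSet_Iio] with t ht
    have hs : 0 < x - t := sub_pos.mpr (mem_Iio.mp ht)
    simp only [gammaKernel, indicator_of_mem (mem_Ioi.mpr hs)]
    rw [← Complex.exp_add]
    simp
    ring_nf
  have h2 := h.integrable_mul ((Lp.memLp g).restrict (Iio x))
  refine (h2.const_mul (Complex.exp x)).congr (.of_forall fun t => ?_)
  simp only [Pi.mul_apply]
  rw [← mul_assoc, ← mul_assoc, ← Complex.exp_add]
  simp

theorem ae_eq_zero_of_forall_setIntegral_Iio {f : ℝ → ℂ} {a : ℝ} (hf : IntegrableOn f (Iio a))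
    (h : ∀ x < a, ∫ t in Iio x, f t = 0) : f =ᵐ[volume.restrict (Iio a)] 0 := by
  have hg : Integrable ((Iio a).indicator f) := (integrable_indicator_iff measurableSet_Iio).mpr hf
  rw [EventuallyEq, ae_restrict_iff' measurableSet_Iio]
  filter_upwards [LocallyIntegrable.ae_hasDerivAt_integral hg.locallyIntegrable] with x hx hxa
  have h0 : ∀ y < a, ∫ t in Iic y, (Iio a).indicator f t = 0 := fun y hy => by
    rw [integral_Iic_eq_integral_Iio, ← h y hy]
    refine setIntegral_congr_fun measurableSet_Iio fun t ht => ?_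
    exact indicator_of_mem (mem_Iio.mpr (lt_trans ht hy)) f
  have hd := hx x
  have hev : (fun y => ∫ t in x..y, (Iio a).indicator f t) =ᶠ[𝓝 x] fun _ => 0 := by
    filter_upwards [Iio_mem_nhds hxa] with y hy
    rw [← intervalIntegral.integral_Iic_sub_Iic hg.integrableOn hg.integrableOn, h0 y hy,
      h0 x hxa, sub_zero]
  have := hd.unique ((hasDerivAt_const x (0 : ℂ)).congr_of_eventuallyEq hev)
  rwa [indicator_of_mem hxa] at this

theorem fourierMultiplier_ae_eq_zero_Iio {β : ℂ} (hβ : β.re = 0)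
    {T : Lp ℂ 2 (volume : Measure ℝ) →L[ℂ] Lp ℂ 2 (volume : Measure ℝ)}
    (hT : IsFourierMultiplier (fun ξ : ℝ => (1 + 2 * Real.pi * Complex.I * ξ : ℂ) ^ (-β)) T)
    {g : Lp ℂ 2 (volume : Measure ℝ)} {a : ℝ} (hg : g =ᵐ[volume.restrict (Iio a)] 0) :
    T g =ᵐ[volume.restrict (Iio a)] 0 := by
  have := ae_eq_zero_of_forall_setIntegral_Iio (integrableOn_Iio_exp_mul (T g) a) fun x hx => by
    rw [setIntegral_Iio_exp_mul_fourierMultiplier hβ hT, integral_eq_zero_of_ae, mul_zero]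
    filter_upwards [ae_restrict_of_ae_restrict_of_subset (Iio_subset_Iio hx.le) hg] with t ht
    simp [ht]
  filter_upwards [this] with t ht
  simpa using ht

theorem integral_Ioo_triangle {f : ℝ → ℂ} {k : ℝ → ℝ → ℂ} {x C : ℝ}
    (hf : IntegrableOn f (Ioo 0 x)) (hk : Measurable (Function.uncurry k))
    (hC : ∀ t s, s < t → t < x → ‖k t s‖ ≤ C) :
    ∫ t in Ioo 0 x, ∫ s in Ioo 0 t, k t s * f s =
      ∫ s in Ioo 0 x, f s * ∫ t in Ioo s x, k t s := by
  set μ := volume.restrict (Ioo (0 : ℝ) x) with hμ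
  let D : Set (ℝ × ℝ) := {p | p.2 < p.1 ∧ p.1 < x}
  have hD : MeasurableSet D :=
    (measurableSet_lt measurable_snd measurable_fst).inter
      (measurableSet_lt measurable_fst measurable_const)
  have hint : Integrable (Function.uncurry fun t s => D.indicator (Function.uncurry k) (t, s) * f s)
      (μ.prod μ) := by
    have hf' : Integrable (fun p : ℝ × ℝ => f p.2) (μ.prod μ) := hf.comp_snd μ
    refine hf'.bdd_mul (c := max C 0) (hk.indicator hD).aestronglyMeasurable
      (.of_forall fun p => ?_)
    by_cases hp : p ∈ D
    · rw [indicator_of_mem hp]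
      exact (hC _ _ hp.1 hp.2).trans (le_max_left _ _)
    · simp [indicator_of_notMem hp]
  calc _ = ∫ t, ∫ s, D.indicator (Function.uncurry k) (t, s) * f s ∂μ ∂μ := by
        refine setIntegral_congr_fun measurableSet_Ioo fun t ht => ?_
        have : Ioo 0 t = Ioo 0 x ∩ Iio t := by
          ext s; simp only [mem_Ioo, mem_inter_iff, mem_Iio]
          exact ⟨fun h => ⟨⟨h.1, h.2.trans ht.2⟩, h.2⟩, fun h => ⟨h.1.1, h.2⟩⟩
        rw [this, ← setIntegral_indicator measurableSet_Iio]
        refine integral_congr_ae (.of_forall fun s => ?_)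
        by_cases hs : s < t
        · simp [D, indicator, hs, ht.2]
        · simp [D, indicator, hs]
    _ = ∫ s, ∫ t, D.indicator (Function.uncurry k) (t, s) * f s ∂μ ∂μ :=
        integral_integral_swap hint
    _ = _ := by
        refine setIntegral_congr_fun measurableSet_Ioo fun s hs => ?_
        have : Ioo s x = Ioo 0 x ∩ Ioi s := by
          ext t; simp only [mem_Ioo, mem_inter_iff, mem_Ioi]
          exact ⟨fun h => ⟨⟨hs.1.trans h.1, h.2⟩, h.1⟩, fun h => ⟨h.2, h.1.2⟩⟩
        rw [this, ← setIntegral_indicator measurableSet_Ioi, mul_comm, ← integral_mul_const]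
        refine setIntegral_congr_fun measurableSet_Ioo fun t ht => ?_
        by_cases hst : s < t
        · simp [D, indicator, hst, ht.2]
        · simp [D, indicator, hst]

theorem integral_Ioo_sub_right_cpow {β : ℂ} (hβ : -1 < β.re) {s x : ℝ} (h : s ≤ x) :
    ∫ t in Ioo s x, ((t - s : ℝ) : ℂ) ^ β = ((x - s : ℝ) : ℂ) ^ (β + 1) / (β + 1) := by
  have hne : β + 1 ≠ 0 := fun h0 => by
    have := congrArg Complex.re h0
    simp at this
    linarith
  rw [← integral_Ioc_eq_integral_Ioo, ← intervalIntegral.integral_of_le h,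
    intervalIntegral.integral_comp_sub_right (fun u : ℝ => (u : ℂ) ^ β) s, sub_self,
    integral_cpow (Or.inl hβ), Complex.ofReal_zero, Complex.zero_cpow hne, sub_zero]

theorem integral_Ioo_sub_left_cpow {β : ℂ} (hβ : -1 < β.re) {s x : ℝ} (h : s ≤ x) :
    ∫ t in Ioo s x, ((x - t : ℝ) : ℂ) ^ β = ((x - s : ℝ) : ℂ) ^ (β + 1) / (β + 1) := by
  have hne : β + 1 ≠ 0 := fun h0 => by
    have := congrArg Complex.re h0
    simp at this
    linarith
  rw [← integral_Ioc_eq_integral_Ioo, ← intervalIntegral.integral_of_le h,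
    intervalIntegral.integral_comp_sub_left (fun u : ℝ => (u : ℂ) ^ β) x, sub_self,
    integral_cpow (Or.inl hβ), Complex.ofReal_zero, Complex.zero_cpow hne, sub_zero]

theorem norm_ofReal_cpow_of_re_eq_zero {β : ℂ} (hβ : β.re = 0) {u : ℝ} (hu : 0 < u) :
    ‖(u : ℂ) ^ β‖ = 1 := by
  rw [Complex.norm_cpow_eq_rpow_re_of_pos hu, hβ, Real.rpow_zero]

theorem integral_Ioo_mul_id_eq_of_fractional {β c : ℂ} (hβ : β.re = 0) {f g : ℝ → ℂ} {x : ℝ}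
    (hf : IntegrableOn f (Ioo 0 x)) (hg : IntegrableOn g (Ioo 0 x)) (hx : 0 < x)
    (h : ∀ t ∈ Ioc 0 x, ∫ s in Ioo 0 t, g s = c * ∫ s in Ioo 0 t, ((t - s : ℝ) : ℂ) ^ β * f s) :
    ∫ t in Ioo 0 x, (t : ℂ) * g t =
      c * ∫ t in Ioo 0 x, ((x - t : ℝ) : ℂ) ^ β * (t * f t + β * ∫ s in Ioo 0 t, f s) := by
  have hβ' : -1 < β.re := by rw [hβ]; norm_num
  have hne : β + 1 ≠ 0 := fun h0 => by
    have := congrArg Complex.re h0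
    simp [hβ] at this
  have hid {u : ℝ → ℂ} (hu : IntegrableOn u (Ioo 0 x)) :
      IntegrableOn (fun t : ℝ => (t : ℂ) * u t) (Ioo 0 x) := by
    refine hu.bdd_mul (c := x) (by fun_prop) ?_
    filter_upwards [ae_restrict_mem measurableSet_Ioo] with t ht
    rw [Complex.norm_real, Real.norm_of_nonneg ht.1.le]
    exact ht.2.le
  have hker {u : ℝ → ℂ} (hu : IntegrableOn u (Ioo 0 x)) :
      IntegrableOn (fun t : ℝ => ((x - t : ℝ) : ℂ) ^ β * u t) (Ioo 0 x) := by
    refine hu.bdd_mul (c := 1) (Measurable.aestronglyMeasurable (by fun_prop)) ?_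
    filter_upwards [ae_restrict_mem measurableSet_Ioo] with t ht
    rw [norm_ofReal_cpow_of_re_eq_zero hβ (sub_pos.mpr ht.2)]
  have hprim : IntegrableOn (fun t : ℝ => ∫ s in Ioo 0 t, f s) (Ioo 0 x) := by
    have hcont : ContinuousOn (fun t => ∫ s in Ioc 0 t, f s) (Icc 0 x) :=
      intervalIntegral.continuousOn_primitive ((integrableOn_Icc_iff_integrableOn_Ioc (by simp)).mpr
        ((integrableOn_Ioc_iff_integrableOn_Ioo (by simp)).mpr hf))
    refine (hcont.integrableOn_Icc.mono_set Ioo_subset_Icc_self).congr (.of_forall fun t => ?_)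
    exact integral_Ioc_eq_integral_Ioo
  have e1 : ∫ t in Ioo 0 x, ∫ s in Ioo 0 t, g s =
      x * (∫ t in Ioo 0 x, g t) - ∫ t in Ioo 0 x, (t : ℂ) * g t := by
    have := integral_Ioo_triangle (k := fun _ _ => 1) (C := 1) hg (by fun_prop) (by simp)
    simp only [one_mul] at this
    rw [this, ← integral_const_mul, ← integral_sub (hg.const_mul _) (hid hg)]
    refine setIntegral_congr_fun measurableSet_Ioo fun s hs => ?_
    simp [hs.2.le]
    ring
  have e2 : ∫ t in Ioo 0 x, ∫ s in Ioo 0 t, g s =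
      c * ∫ s in Ioo 0 x, f s * (((x - s : ℝ) : ℂ) ^ (β + 1) / (β + 1)) := by
    have := integral_Ioo_triangle (k := fun t s => ((t - s : ℝ) : ℂ) ^ β) (C := 1) hf
      (by unfold Function.uncurry; fun_prop)
      (fun t s hst _ => (norm_ofReal_cpow_of_re_eq_zero hβ (sub_pos.mpr hst)).le)
    rw [setIntegral_congr_fun measurableSet_Ioo fun t ht => h t ⟨ht.1, ht.2.le⟩,
      integral_const_mul, this]
    congr 1
    refine setIntegral_congr_fun measurableSet_Ioo fun s hs => ?_
    rw [integral_Ioo_sub_right_cpow hβ' hs.2.le]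
  have e3 : ∫ t in Ioo 0 x, ((x - t : ℝ) : ℂ) ^ β * ∫ s in Ioo 0 t, f s =
      ∫ s in Ioo 0 x, f s * (((x - s : ℝ) : ℂ) ^ (β + 1) / (β + 1)) := by
    have := integral_Ioo_triangle (k := fun t _ => ((x - t : ℝ) : ℂ) ^ β) (C := 1) hf
      (by unfold Function.uncurry; fun_prop)
      (fun t s _ htx => (norm_ofReal_cpow_of_re_eq_zero hβ (sub_pos.mpr htx)).le)
    simp only [integral_const_mul] at this
    rw [this]
    refine setIntegral_congr_fun measurableSet_Ioo fun s hs => ?_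
    rw [integral_Ioo_sub_left_cpow hβ' hs.2.le]
  have e4 : ∫ s in Ioo 0 x, f s * (((x - s : ℝ) : ℂ) ^ (β + 1) / (β + 1)) =
      (x * (∫ t in Ioo 0 x, ((x - t : ℝ) : ℂ) ^ β * f t) -
        ∫ t in Ioo 0 x, ((x - t : ℝ) : ℂ) ^ β * (t * f t)) / (β + 1) := by
    rw [← integral_const_mul, ← integral_sub ((hker hf).const_mul _) (hker (hid hf)),
      ← integral_div]
    refine setIntegral_congr_fun measurableSet_Ioo fun s hs => ?_
    rw [Complex.cpow_add _ _ (Complex.ofReal_ne_zero.mpr (sub_pos.mpr hs.2).ne'), Complex.cpow_one]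
    push_cast
    ring
  have e5 : ∫ t in Ioo 0 x, ((x - t : ℝ) : ℂ) ^ β * (t * f t + β * ∫ s in Ioo 0 t, f s) =
      (∫ t in Ioo 0 x, ((x - t : ℝ) : ℂ) ^ β * (t * f t)) +
        β * ∫ t in Ioo 0 x, ((x - t : ℝ) : ℂ) ^ β * ∫ s in Ioo 0 t, f s := by
    rw [← integral_const_mul, ← integral_add (hker (hid hf)) ((hker hprim).const_mul _)]
    refine integral_congr_ae (.of_forall fun t => ?_)
    ring
  have h0 := h x ⟨hx, le_rfl⟩
  rw [e1, h0, e4] at e2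
  rw [e5, e3, e4]
  rw [sub_eq_iff_eq_add] at e2
  field_simp at e2 ⊢
  linear_combination -e2

theorem ae_eq_of_forall_setIntegral_Ioo {f g : ℝ → ℂ} {ℓ : ℝ}
    (hf : IntegrableOn f (Ioo 0 ℓ)) (hg : IntegrableOn g (Ioo 0 ℓ))
    (h : ∀ x ∈ Ioo 0 ℓ, ∫ t in Ioo 0 x, f t = ∫ t in Ioo 0 x, g t) :
    f =ᵐ[volume.restrict (Ioo 0 ℓ)] g := by
  have hd : IntegrableOn (fun t => f t - g t) (Ioo 0 ℓ) := hf.sub hg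
  have key := ae_eq_zero_of_forall_setIntegral_Iio (a := ℓ)
    ((integrable_indicator_iff measurableSet_Ioo).mpr hd).integrableOn fun x hx => by
      rw [setIntegral_indicator measurableSet_Ioo]
      have hset : Iio x ∩ Ioo 0 ℓ = Ioo 0 x := by
        ext t; simp only [mem_Ioo, mem_inter_iff, mem_Iio]
        exact ⟨fun h => ⟨h.2.1, h.1⟩, fun h => ⟨h.2, h.1, h.2.trans hx⟩⟩
      rw [hset]
      rcases le_or_gt x 0 with hx0 | hx0
      · simp [Ioo_eq_empty_of_le hx0]
      · have hsub : Ioo 0 x ⊆ Ioo 0 ℓ := Ioo_subset_Ioo_right hx.le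
        rw [integral_sub (hf.mono_set hsub) (hg.mono_set hsub), h x ⟨hx0, hx⟩, sub_self]
  have hsub : Ioo 0 ℓ ⊆ Iio ℓ := fun t ht => ht.2
  filter_upwards [ae_restrict_of_ae_restrict_of_subset hsub key,
    ae_restrict_mem measurableSet_Ioo] with t ht hmem
  rw [indicator_of_mem hmem] at ht
  exact sub_eq_zero.mp ht

theorem exists_fractional_inverse_pair (ℓ : ℝ) {β : ℂ} (hβ : β.re = 0) :
    ∃ B C : Lp ℂ 2 (volume.restrict (Ioo 0 ℓ)) →L[ℂ] Lp ℂ 2 (volume.restrict (Ioo 0 ℓ)),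
      B ∘L C = 1 ∧ C ∘L B = 1 ∧
      (∀ f : Lp ℂ 2 (volume.restrict (Ioo 0 ℓ)), ∀ x ∈ Ioo 0 ℓ,
        ∫ t in Ioo 0 x, (B f : ℝ → ℂ) t =
          (1 / Complex.Gamma (1 + β)) * ∫ t in Ioo 0 x, ((x - t : ℝ) : ℂ) ^ β * f t) ∧
      (∀ f : Lp ℂ 2 (volume.restrict (Ioo 0 ℓ)), ∀ x ∈ Ioo 0 ℓ,
        ∫ t in Ioo 0 x, (C f : ℝ → ℂ) t =
          (1 / Complex.Gamma (1 - β)) * ∫ t in Ioo 0 x, ((x - t : ℝ) : ℂ) ^ (-β) * f t) := by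
  set S : Set ℝ := Ioo 0 ℓ with hS
  have hSm : MeasurableSet S := measurableSet_Ioo
  have hbdd (ε : ℂ) : MemLp (fun t : ℝ => Complex.exp (ε * t)) ∞ (volume.restrict S) := by
    refine memLp_top_of_bound (by fun_prop) (Real.exp (|ε.re| * ℓ)) ?_
    filter_upwards [ae_restrict_mem hSm] with t ht
    rw [Complex.norm_exp, Complex.re_mul_ofReal]
    refine Real.exp_le_exp.mpr ?_
    exact mul_le_mul (le_abs_self _) ht.2.le ht.1.le (abs_nonneg _)
  obtain ⟨Mp, hMp⟩ := exists_mulCLM (hbdd 1)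
  obtain ⟨Mm, hMm⟩ := exists_mulCLM (hbdd (-1))
  obtain ⟨E₀, hE₀⟩ := exists_extendCLM (μ := (volume : Measure ℝ)) hSm
  let R₀ := LpToLpRestrictCLM ℝ ℂ ℂ volume 2 S
  let E := E₀ ∘L Mm
  let R := Mp ∘L R₀
  have hE (f : Lp ℂ 2 (volume.restrict S)) :
      E f =ᵐ[volume] S.indicator fun t => Complex.exp (-t) * f t := by
    refine (hE₀ (Mm f)).trans ((ae_eq_restrict_iff_indicator_ae_eq hSm).mp ?_)
    filter_upwards [hMm f] with t ht
    simp [ht]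
  have hR (g : Lp ℂ 2 (volume : Measure ℝ)) :
      R g =ᵐ[volume.restrict S] fun t => Complex.exp t * g t := by
    filter_upwards [hMp (R₀ g), LpToLpRestrictCLM_coeFn ℂ S g] with t h1 h2
    refine h1.trans ?_
    rw [h2, one_mul]
  have hE0 (f : Lp ℂ 2 (volume.restrict S)) : E f =ᵐ[volume.restrict (Iio 0)] 0 := by
    filter_upwards [ae_restrict_of_ae (hE f), ae_restrict_mem measurableSet_Iio] with t h1 h2
    rw [h1, indicator_of_notMem fun h => lt_asymm h.1 h2]
    rfl
  have hformula {γ : ℂ} (hγ : γ.re = 0)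
      {T : Lp ℂ 2 (volume : Measure ℝ) →L[ℂ] Lp ℂ 2 (volume : Measure ℝ)}
      (hT : IsFourierMultiplier (fun ξ : ℝ => (1 + 2 * Real.pi * Complex.I * ξ : ℂ) ^ (-γ)) T)
      (f : Lp ℂ 2 (volume.restrict S)) (x : ℝ) (hx : x ∈ S) :
      ∫ t in Ioo 0 x, ((R ∘L T ∘L E) f : ℝ → ℂ) t =
          (1 / Complex.Gamma (1 + γ)) * ∫ t in Ioo 0 x, ((x - t : ℝ) : ℂ) ^ γ * f t := by
    have hsub : Ioo 0 x ⊆ S := Ioo_subset_Ioo_right hx.2.le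
    have hset {h : ℝ → ℂ} (h0 : h =ᵐ[volume.restrict (Iio 0)] 0) :
        ∫ t in Iio x, h t = ∫ t in Ioo 0 x, h t := by
      refine setIntegral_eq_of_subset_of_ae_sdiff_eq_zero
        measurableSet_Iio.nullMeasurableSet (fun t ht => ht.2) ?_
      rw [restrict_Iio_eq_restrict_Iic, EventuallyEq, ae_restrict_iff' measurableSet_Iic] at h0
      filter_upwards [h0] with t ht hmem
      exact ht (not_lt.mp fun h => hmem.2 ⟨h, hmem.1⟩)
    have hTE := fourierMultiplier_ae_eq_zero_Iio hγ hT (hE0 f)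
    calc _ = ∫ t in Ioo 0 x, Complex.exp t * T (E f) t :=
          integral_congr_ae (ae_restrict_of_ae_restrict_of_subset hsub (hR _))
      _ = ∫ t in Iio x, Complex.exp t * T (E f) t := by
          refine (hset ?_).symm
          filter_upwards [hTE] with t ht
          simp [ht]
      _ = _ := setIntegral_Iio_exp_mul_fourierMultiplier hγ hT (E f) x
      _ = (1 / Complex.Gamma (1 + γ)) *
          ∫ t in Ioo 0 x, ((x - t : ℝ) : ℂ) ^ γ * (Complex.exp t * E f t) := by
          rw [hset]
          filter_upwards [hE0 f] with t ht
          simp [ht]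
      _ = _ := by
          congr 1
          refine integral_congr_ae ?_
          filter_upwards [ae_restrict_of_ae (hE f), ae_restrict_mem measurableSet_Ioo]
            with t h1 h2
          rw [h1, indicator_of_mem (hsub h2), ← mul_assoc (Complex.exp t), ← Complex.exp_add]
          simp
  have hinv {γ : ℂ} (hγ : γ.re = 0)
      {T T' : Lp ℂ 2 (volume : Measure ℝ) →L[ℂ] Lp ℂ 2 (volume : Measure ℝ)}
      (hT : IsFourierMultiplier (fun ξ : ℝ => (1 + 2 * Real.pi * Complex.I * ξ : ℂ) ^ (-γ)) T)
      (hT' : IsFourierMultiplier (fun ξ : ℝ => (1 + 2 * Real.pi * Complex.I * ξ : ℂ) ^ γ) T') :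
      (R ∘L T' ∘L E) ∘L (R ∘L T ∘L E) = 1 := by
    refine ContinuousLinearMap.ext fun f => Lp.ext ?_
    set h := T (E f) with hh
    have hcut : (h - E (R h) : Lp ℂ 2 (volume : Measure ℝ)) =ᵐ[volume.restrict (Iio ℓ)] 0 := by
      have h0 := fourierMultiplier_ae_eq_zero_Iio hγ hT (hE0 f)
      rw [restrict_Iio_eq_restrict_Iic, EventuallyEq, ae_restrict_iff' measurableSet_Iic] at h0
      have hR' := hR h
      rw [EventuallyEq, ae_restrict_iff' hSm] at hR'
      filter_upwards [ae_restrict_of_ae h0, ae_restrict_of_ae hR', ae_restrict_of_ae (hE (R h)),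
        ae_restrict_of_ae (Lp.coeFn_sub h (E (R h))), ae_restrict_mem measurableSet_Iio]
        with t h1 h2 h3 h4 h5
      rw [h4, Pi.sub_apply, h3]
      by_cases ht : t ∈ S
      · rw [indicator_of_mem ht, h2 ht, ← mul_assoc, ← Complex.exp_add]
        simp
      · rw [indicator_of_notMem ht, h1 (not_lt.mp fun h => ht ⟨h, h5⟩)]
        simp
    have hγ' : (-γ).re = 0 := by rw [Complex.neg_re, hγ, neg_zero]
    have hcut' := fourierMultiplier_ae_eq_zero_Iio hγ' (by simpa using hT') hcut
    rw [map_sub, hh, fourierMultiplier_leftInverse hT hT'] at hcut'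
    have hsub : S ⊆ Iio ℓ := fun t ht => ht.2
    filter_upwards [ae_restrict_of_ae_restrict_of_subset hsub hcut', hR (T' (E (R h))),
      ae_restrict_of_ae (Lp.coeFn_sub (E f) (T' (E (R h)))), ae_restrict_of_ae (hE f),
      ae_restrict_mem hSm] with t h1 h2 h3 h4 h5
    refine h2.trans ?_
    rw [h3, Pi.sub_apply, Pi.zero_apply, sub_eq_zero] at h1
    rw [← h1, h4, indicator_of_mem h5, ← mul_assoc, ← Complex.exp_add]
    simp
  have hβ' : (-β).re = 0 := by rw [Complex.neg_re, hβ, neg_zero]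
  obtain ⟨T, hT⟩ := exists_isFourierMultiplier (memLp_top_fourierSymbol hβ)
  obtain ⟨T', hT'⟩ := exists_isFourierMultiplier (memLp_top_fourierSymbol hβ')
  refine ⟨R ∘L T ∘L E, R ∘L T' ∘L E, hinv hβ' hT' hT, hinv hβ hT (by simpa using hT'),
    hformula hβ hT, ?_⟩
  simpa only [sub_eq_add_neg] using hformula hβ' hT'

/-- Theorem 9.1: the triangular Livšic model operator
`(Af)(x) = x f(x) + iα ∫₀ˣ f(t) dt` on `L²(0, ℓ)` is reduced to diagonal
(multiplication) form by the fractional-integration similarity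
`B = 𝒥^{iα}`: there are bounded mutually inverse operators `B`, `C` with
`∫₀ˣ (Bf)(t) dt = (1/Γ(1+iα)) ∫₀ˣ (x-t)^{iα} f(t) dt`,
`∫₀ˣ (Cf)(t) dt = (1/Γ(1-iα)) ∫₀ˣ (x-t)^{-iα} f(t) dt`,
and `BA = QB`, i.e. `A = CQB`, where `Q` is multiplication by `x`. -/
theorem stmt_15 (ℓ : ℝ) (hℓ : 0 < ℓ) (α : ℝ)
    (A Q : Lp ℂ 2 (volume.restrict (Set.Ioo 0 ℓ)) →L[ℂ]
           Lp ℂ 2 (volume.restrict (Set.Ioo 0 ℓ)))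
    (hA : ∀ f : Lp ℂ 2 (volume.restrict (Set.Ioo 0 ℓ)),
      ∀ᵐ x ∂(volume.restrict (Set.Ioo 0 ℓ)),
        (A f : ℝ → ℂ) x = (x : ℂ) * f x +
          Complex.I * (α : ℂ) * ∫ t in Set.Ioo 0 x, f t)
    (hQ : ∀ f : Lp ℂ 2 (volume.restrict (Set.Ioo 0 ℓ)),
      ∀ᵐ x ∂(volume.restrict (Set.Ioo 0 ℓ)),
        (Q f : ℝ → ℂ) x = (x : ℂ) * f x) :
    ∃ B C : Lp ℂ 2 (volume.restrict (Set.Ioo 0 ℓ)) →L[ℂ]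
            Lp ℂ 2 (volume.restrict (Set.Ioo 0 ℓ)),
      B ∘L C = 1 ∧ C ∘L B = 1 ∧
      (∀ f : Lp ℂ 2 (volume.restrict (Set.Ioo 0 ℓ)),
        ∀ᵐ x ∂(volume.restrict (Set.Ioo 0 ℓ)),
          ∫ t in Set.Ioo 0 x, (B f : ℝ → ℂ) t =
            (1 / Complex.Gamma (1 + Complex.I * (α : ℂ))) *
              ∫ t in Set.Ioo 0 x, ((x - t : ℝ) : ℂ) ^ (Complex.I * (α : ℂ)) * f t) ∧
      (∀ f : Lp ℂ 2 (volume.restrict (Set.Ioo 0 ℓ)),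
        ∀ᵐ x ∂(volume.restrict (Set.Ioo 0 ℓ)),
          ∫ t in Set.Ioo 0 x, (C f : ℝ → ℂ) t =
            (1 / Complex.Gamma (1 - Complex.I * (α : ℂ))) *
              ∫ t in Set.Ioo 0 x, ((x - t : ℝ) : ℂ) ^ (-(Complex.I * (α : ℂ))) * f t) ∧
      B ∘L A = Q ∘L B ∧ A = C ∘L Q ∘L B := by
  have hβ : (Complex.I * (α : ℂ)).re = 0 := by simp
  obtain ⟨B, C, hBC, hCB, hB, hC⟩ := exists_fractional_inverse_pair ℓ hβ
  have hint (f : Lp ℂ 2 (volume.restrict (Ioo 0 ℓ))) : IntegrableOn f (Ioo 0 ℓ) :=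
    (Lp.memLp f).integrable (by norm_num)
  have hBA : B ∘L A = Q ∘L B := by
    refine ContinuousLinearMap.ext fun f => Lp.ext ?_
    refine ae_eq_of_forall_setIntegral_Ioo (hint _) (hint _) fun x hx => ?_
    have hsub : Ioo 0 x ⊆ Ioo 0 ℓ := Ioo_subset_Ioo_right hx.2.le
    have key := integral_Ioo_mul_id_eq_of_fractional hβ ((hint f).mono_set hsub)
      ((hint (B f)).mono_set hsub) hx.1 fun t ht => hB f t ⟨ht.1, ht.2.trans_lt hx.2⟩
    refine (hB (A f) x hx).trans (Eq.trans ?_ (key.symm.trans ?_))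
    · congr 1
      refine integral_congr_ae ?_
      filter_upwards [ae_restrict_of_ae_restrict_of_subset hsub (hA f)] with t ht
      rw [ht]
    · exact (integral_congr_ae (ae_restrict_of_ae_restrict_of_subset hsub (hQ (B f)))).symm
  refine ⟨B, C, hBC, hCB, fun f => ?_, fun f => ?_, hBA, ?_⟩
  · exact (ae_restrict_mem measurableSet_Ioo).mono (hB f)
  · exact (ae_restrict_mem measurableSet_Ioo).mono (hC f)
  · rw [← hBA, ← ContinuousLinearMap.comp_assoc, hCB]
    rfl
end
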